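/- arXiv:math/0607153 — 4 statements merged into one kernel-verified Lean document; each statement's English description precedes it below -/
import Mathlib

section
/- Let p ≥ 3 and q ≥ 1. Let Ω ⊂ M₀ be a connected open set and let f : Ω → M₀ be a smooth local isometry of the metric g, i.e. g_{f(z)}(Df(z)U, Df(z)V) = g_z(U, V) for all z ∈ Ω and U, V ∈ ℝ^{p+q}. Then f is the restriction of a map of the form (x, y) ↦ (Ax, By + b), where A ∈ O(p), B ∈ O(q) and b ∈ ℝ^q. -/
noncomputable section

open scoped RealInnerProductSpace

/-- Points/tangent vectors of `M = ℝ^p × ℝ^q` with Euclidean norms on the factors. -/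
abbrev GVec (p q : ℕ) := EuclideanSpace ℝ (Fin p) × EuclideanSpace ℝ (Fin q)

/-- The set `M₀ = (ℝ^p \ {0}) × ℝ^q`. -/
def GM0 (p q : ℕ) : Set (GVec p q) := {z | z.1 ≠ 0}

/-- Homogeneous norm `‖(x,y)‖ = (|x|^{2(α+1)} + |y|²)^{1/(2(α+1))}`. -/
def homNorm (α : ℝ) (p q : ℕ) (z : GVec p q) : ℝ :=
  (‖z.1‖ ^ (2 * (α + 1)) + ‖z.2‖ ^ 2) ^ (1 / (2 * (α + 1)))

/-- Anisotropic dilation `δ_t(x,y) = (t x, t^{α+1} y)`. -/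
def gdil (α : ℝ) (p q : ℕ) (t : ℝ) (z : GVec p q) : GVec p q :=
  (t • z.1, (t ^ (α + 1)) • z.2)

/-- Grushin inversion `Φ(z) = δ_{‖z‖^{-2}} z = (x/‖z‖², y/‖z‖^{2(α+1)})`. -/
def ginv (α : ℝ) (p q : ℕ) (z : GVec p q) : GVec p q :=
  ((homNorm α p q z ^ (-(2:ℝ))) • z.1, (homNorm α p q z ^ (-(2 * (α + 1)))) • z.2)

/-- The Riemannian metric `g = (α+1)²|x|^{2α}|dx|² + |dy|²` (depends on the point through `x`). -/
def gMet (α : ℝ) (p q : ℕ) (x : EuclideanSpace ℝ (Fin p)) (U V : GVec p q) : ℝ :=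
  (α + 1) ^ 2 * ‖x‖ ^ (2 * α) * ⟪U.1, V.1⟫ + ⟪U.2, V.2⟫

/-- The Riemannian metric `ĝ = |dx|² + |dy|²/((α+1)²|x|^{2α})`. -/
def ghat (α : ℝ) (p q : ℕ) (x : EuclideanSpace ℝ (Fin p)) (U V : GVec p q) : ℝ :=
  ⟪U.1, V.1⟫ + ⟪U.2, V.2⟫ / ((α + 1) ^ 2 * ‖x‖ ^ (2 * α))

/-- Contraction `Γ(U,V)^k = Γ^k_{ij}U^iV^j` of the Christoffel symbols
`Γ^k_{ij} = α|x|^{-2}(δ_{ik}x_j + δ_{jk}x_i − δ_{ij}x_k)` (x-indices; all other symbols zero). -/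
def gammaMap (α : ℝ) (p q : ℕ) (x : EuclideanSpace ℝ (Fin p)) (U V : GVec p q) : GVec p q :=
  ((α * ‖x‖ ^ (-(2:ℝ))) • (⟪x, V.1⟫ • U.1 + ⟪x, U.1⟫ • V.1 - ⟪U.1, V.1⟫ • x), 0)

/-- Covariant derivative `∇_U V` of a vector field `V` along the constant direction `U`, at `z`. -/
def covDeriv (α : ℝ) (p q : ℕ) (V : GVec p q → GVec p q) (z : GVec p q) (U : GVec p q) :
    GVec p q :=
  fderiv ℝ V z U + gammaMap α p q z.1 U (V z)

/-- Curvature operator `R(X,Y)Z = ∇_X ∇_Y Z − ∇_Y ∇_X Z` on constant (hence commuting) vector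
fields `X, Y, Z`, evaluated at `z`. -/
def curvOp (α : ℝ) (p q : ℕ) (z : GVec p q) (X Y Z : GVec p q) : GVec p q :=
  covDeriv α p q (fun w => gammaMap α p q w.1 Y Z) z X
    - covDeriv α p q (fun w => gammaMap α p q w.1 X Z) z Y

/-- Riemann curvature tensor `R(U,V,X,Y) = g(U, R(X,Y)V)`. -/
def riem (α : ℝ) (p q : ℕ) (z : GVec p q) (U V X Y : GVec p q) : ℝ :=
  gMet α p q z.1 U (curvOp α p q z X Y V)

/-- Ricci tensor `Ric(X,Y) = trace (V ↦ R(V,Y)X)`. -/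
def ricci (α : ℝ) (p q : ℕ) (z : GVec p q) (X Y : GVec p q) : ℝ :=
  (∑ i : Fin p, (curvOp α p q z (EuclideanSpace.single i 1, 0) Y X).1 i)
    + ∑ l : Fin q, (curvOp α p q z (0, EuclideanSpace.single l 1) Y X).2 l

/-- Scalar curvature: the `g`-trace of the Ricci tensor. -/
def scal (α : ℝ) (p q : ℕ) (z : GVec p q) : ℝ :=
  ((α + 1) ^ 2 * ‖z.1‖ ^ (2 * α))⁻¹ *
      (∑ i : Fin p, ricci α p q z (EuclideanSpace.single i 1, 0) (EuclideanSpace.single i 1, 0))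
    + ∑ l : Fin q, ricci α p q z (0, EuclideanSpace.single l 1) (0, EuclideanSpace.single l 1)

/-- The Weyl tensor
`W = R + (1/(n−2)) Ric ⊙ g − (Scal/(2(n−1)(n−2))) g ⊙ g`, where
`(h ⊙ s)(X₁,X₂,X₃,X₄) = h(X₁,X₄)s(X₂,X₃) + h(X₂,X₃)s(X₁,X₄) − h(X₁,X₃)s(X₂,X₄) − h(X₂,X₄)s(X₁,X₃)`
and `n = p + q`. -/
def weyl (α : ℝ) (p q : ℕ) (z : GVec p q) (X₁ X₂ X₃ X₄ : GVec p q) : ℝ :=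
  riem α p q z X₁ X₂ X₃ X₄
    + ((p + q : ℝ) - 2)⁻¹ *
        (ricci α p q z X₁ X₄ * gMet α p q z.1 X₂ X₃ + ricci α p q z X₂ X₃ * gMet α p q z.1 X₁ X₄
          - ricci α p q z X₁ X₃ * gMet α p q z.1 X₂ X₄
          - ricci α p q z X₂ X₄ * gMet α p q z.1 X₁ X₃)
    - scal α p q z / (2 * ((p + q : ℝ) - 1) * ((p + q : ℝ) - 2)) *
        (gMet α p q z.1 X₁ X₄ * gMet α p q z.1 X₂ X₃ + gMet α p q z.1 X₂ X₃ * gMet α p q z.1 X₁ X₄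
          - gMet α p q z.1 X₁ X₃ * gMet α p q z.1 X₂ X₄
          - gMet α p q z.1 X₂ X₄ * gMet α p q z.1 X₁ X₃)

/-- Vertical subspace `T_z S = {(v,0) : ⟨v,x⟩ = 0}`. -/
def TSp (p q : ℕ) (z : GVec p q) : Set (GVec p q) := {U | U.2 = 0 ∧ ⟪U.1, z.1⟫ = 0}

/-- Horizontal subspace `T_z H = {(t x, w) : t ∈ ℝ, w ∈ ℝ^q}`. -/
def THp (p q : ℕ) (z : GVec p q) : Set (GVec p q) := {U | ∃ t : ℝ, U.1 = t • z.1}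

/-- `g`-orthogonal projection of `U` onto the vertical subspace `T_z S`. -/
def projS (p q : ℕ) (z : GVec p q) (U : GVec p q) : GVec p q :=
  (U.1 - (⟪U.1, z.1⟫ / ‖z.1‖ ^ 2) • z.1, 0)

/-- Control (Carnot–Carathéodory) distance of the Grushin vector fields
`X_j = ∂_{x_j}`, `Y_λ = (α+1)|x|^α ∂_{y_λ}`: the infimum of `∫₀ᵀ √(|a|²+|b|²)` over absolutely
continuous admissible paths `γ̇ = Σ aⱼ Xⱼ(γ) + Σ b_λ Y_λ(γ)` joining the two points. -/
def grushinDist (α : ℝ) (p q : ℕ) (z z' : GVec p q) : ℝ :=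
  sInf { L : ℝ |
    ∃ (T : ℝ) (γ : ℝ → GVec p q) (a : ℝ → EuclideanSpace ℝ (Fin p))
      (b : ℝ → EuclideanSpace ℝ (Fin q)),
      0 ≤ T ∧ γ 0 = z ∧ γ T = z' ∧
      (∀ t ∈ Set.Icc (0:ℝ) T,
        γ t = (z.1 + ∫ s in (0:ℝ)..t, a s,
               z.2 + ∫ s in (0:ℝ)..t, ((α + 1) * ‖(γ s).1‖ ^ α) • b s)) ∧
      L = ∫ t in (0:ℝ)..T, Real.sqrt (‖a t‖ ^ 2 + ‖b t‖ ^ 2) }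


section ChristoffelTransformation

variable {X : Type*} [NormedAddCommGroup X] [NormedSpace ℝ X]

/-- The second derivative of a local isometry is the difference of the Christoffel symbols. -/
theorem fderiv_fderiv_of_isometry [FiniteDimensional ℝ X]
    {g : X → X →L[ℝ] X →L[ℝ] ℝ} {Γ : X → X →L[ℝ] X →L[ℝ] X} {f : X → X} {z : X}
    (hf : ContDiffAt ℝ 2 f z)
    (hg : DifferentiableAt ℝ g z) (hg' : DifferentiableAt ℝ g (f z))
    (hΓ : ∀ W U V, fderiv ℝ g z W U V = g z (Γ z W U) V + g z U (Γ z W V))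
    (hΓ' : ∀ W U V, fderiv ℝ g (f z) W U V =
      g (f z) (Γ (f z) W U) V + g (f z) U (Γ (f z) W V))
    (htor : ∀ U V, Γ z U V = Γ z V U) (htor' : ∀ U V, Γ (f z) U V = Γ (f z) V U)
    (hsymm : ∀ U V, g (f z) U V = g (f z) V U)
    (hnondeg : ∀ U, (∀ V, g z U V = 0) → U = 0)
    (hnondeg' : ∀ U, (∀ V, g (f z) U V = 0) → U = 0)
    (hiso : ∀ᶠ w in nhds z, ∀ U V, g (f w) (fderiv ℝ f w U) (fderiv ℝ f w V) = g w U V)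
    (U V : X) :
    fderiv ℝ (fderiv ℝ f) z U V =
      fderiv ℝ f z (Γ z U V) - Γ (f z) (fderiv ℝ f z U) (fderiv ℝ f z V) := by
  set L := fderiv ℝ f z with hL
  set Q := fderiv ℝ (fderiv ℝ f) z with hQ
  have hfd : HasFDerivAt f L z := (hf.differentiableAt (by norm_num)).hasFDerivAt
  have hLd : HasFDerivAt (fderiv ℝ f) Q z :=
    ((hf.fderiv_right (m := 1) (by norm_num)).differentiableAt (by norm_num)).hasFDerivAt
  have hQs : ∀ U V, Q U V = Q V U := fun U V => hf.isSymmSndFDerivAt (by simp) U V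
  have hL0 : ∀ U V, g (f z) (L U) (L V) = g z U V := hiso.self_of_nhds
  have hinj : Function.Injective L := by
    rw [injective_iff_map_eq_zero]
    intro U hU
    exact hnondeg U fun V => by rw [← hL0, hU]; simp
  have hsurj : Function.Surjective L :=
    LinearMap.injective_iff_surjective (f := L.toLinearMap).1 hinj
  have key : ∀ W U V, g (f z) (Q W U + Γ (f z) (L W) (L U) - L (Γ z W U)) (L V)
      + g (f z) (L U) (Q W V + Γ (f z) (L W) (L V) - L (Γ z W V)) = 0 := by
    intro W U V
    have hgf : HasFDerivAt (fun w => g (f w)) ((fderiv ℝ g (f z)).comp L) z :=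
      HasFDerivAt.comp (G := X →L[ℝ] X →L[ℝ] ℝ) (g := g) z hg'.hasFDerivAt hfd
    have h1 := (hgf.clm_apply
      (hLd.clm_apply (hasFDerivAt_const U z))).clm_apply (hLd.clm_apply (hasFDerivAt_const V z))
    have h2 := (hg.hasFDerivAt.clm_apply (hasFDerivAt_const U z)).clm_apply
      (hasFDerivAt_const V z)
    have h3 := h1.unique (h2.congr_of_eventuallyEq (by
      filter_upwards [hiso] with w hw using hw U V))
    have h4 := congrArg (fun T => T W) h3
    simp [← hL, hΓ, hΓ'] at h4
    simp only [map_add, map_sub, add_apply, sub_apply, hL0]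
    linarith
  have hB : Q U V + Γ (f z) (L U) (L V) - L (Γ z U V) = 0 := by
    apply hnondeg'
    intro Y
    obtain ⟨W, rfl⟩ := hsurj Y
    set B : X → X → X := fun U V => Q U V + Γ (f z) (L U) (L V) - L (Γ z U V) with hBdef
    have hBs : ∀ U V, B U V = B V U := fun U V => by
      simp only [hBdef]; rw [hQs, htor, htor']
    have k : ∀ W U V, g (f z) (B W U) (L V) + g (f z) (B W V) (L U) = 0 := fun W U V => by
      rw [hsymm (B W V)]; exact key W U V
    change g (f z) (B U V) (L W) = 0
    have k1 := k U V W
    have k2 := k W U V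
    have k3 := k V W U
    rw [hBs V W, hBs V U] at k3
    rw [hBs W U] at k2
    linarith
  rw [← sub_eq_zero, ← hB]
  abel

/-- Curvature operator of the connection with Christoffel map `Γ`, on constant vector fields. -/
def christoffelCurvature (Γ : X → X →L[ℝ] X →L[ℝ] X) (z U V W : X) : X :=
  fderiv ℝ Γ z U V W - fderiv ℝ Γ z V U W + (Γ z U (Γ z V W) - Γ z V (Γ z U W))

/-- Affine maps intertwine the curvature operators. -/
theorem map_christoffelCurvature {Γ : X → X →L[ℝ] X →L[ℝ] X} {f : X → X} {z : X}
    (hf : ContDiffAt ℝ 3 f z)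
    (hΓ : DifferentiableAt ℝ Γ z) (hΓ' : DifferentiableAt ℝ Γ (f z))
    (haff : ∀ᶠ w in nhds z, ∀ U V, fderiv ℝ (fderiv ℝ f) w U V =
      fderiv ℝ f w (Γ w U V) - Γ (f w) (fderiv ℝ f w U) (fderiv ℝ f w V)) (U V W : X) :
    fderiv ℝ f z (christoffelCurvature Γ z U V W) =
      christoffelCurvature Γ (f z) (fderiv ℝ f z U) (fderiv ℝ f z V) (fderiv ℝ f z W) := by
  have hf1 : ContDiffAt ℝ 2 (fderiv ℝ f) z := hf.fderiv_right (by norm_num)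
  have hf2 : ContDiffAt ℝ 1 (fderiv ℝ (fderiv ℝ f)) z := hf1.fderiv_right (by norm_num)
  have hfd := (hf.differentiableAt (by norm_num)).hasFDerivAt
  have hLd := (hf1.differentiableAt (by norm_num)).hasFDerivAt
  have hQd := (hf2.differentiableAt (by norm_num)).hasFDerivAt
  have hTs : ∀ U V, fderiv ℝ (fderiv ℝ (fderiv ℝ f)) z U V =
    fderiv ℝ (fderiv ℝ (fderiv ℝ f)) z V U := fun U V => hf1.isSymmSndFDerivAt (by simp) U V
  have hQ0 := haff.self_of_nhds
  have hQs : ∀ U V, fderiv ℝ (fderiv ℝ f) z U V = fderiv ℝ (fderiv ℝ f) z V U :=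
    fun U V => (hf.of_le (by norm_num)).isSymmSndFDerivAt (n := 2) (by simp) U V
  have hΓf : HasFDerivAt (fun w => Γ (f w)) ((fderiv ℝ Γ (f z)).comp (fderiv ℝ f z)) z :=
    HasFDerivAt.comp (G := X →L[ℝ] X →L[ℝ] X) (g := Γ) z hΓ'.hasFDerivAt hfd
  have hT : ∀ U V, fderiv ℝ (fderiv ℝ (fderiv ℝ f)) z U V W =
      fderiv ℝ f z (fderiv ℝ Γ z U V W) + fderiv ℝ (fderiv ℝ f) z U (Γ z V W)
      - (Γ (f z) (fderiv ℝ f z V) (fderiv ℝ (fderiv ℝ f) z U W)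
        + (Γ (f z) (fderiv ℝ (fderiv ℝ f) z U V) (fderiv ℝ f z W)
          + fderiv ℝ Γ (f z) (fderiv ℝ f z U) (fderiv ℝ f z V) (fderiv ℝ f z W))) := by
    intro U V
    have h1 := (hQd.clm_apply (hasFDerivAt_const V z)).clm_apply (hasFDerivAt_const W z)
    have h2 := (hLd.clm_apply ((hΓ.hasFDerivAt.clm_apply (hasFDerivAt_const V z)).clm_apply
      (hasFDerivAt_const W z))).sub ((hΓf.clm_apply
      (hLd.clm_apply (hasFDerivAt_const V z))).clm_apply (hLd.clm_apply (hasFDerivAt_const W z)))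
    have h3 := h1.unique (h2.congr_of_eventuallyEq
      (by filter_upwards [haff] with w hw using hw V W))
    simpa using congrArg (fun T => T U) h3
  have h := (hT U V).symm.trans ((congrArg (fun T => T W) (hTs U V)).trans (hT V U))
  rw [hQs V U, hQ0 U W, hQ0 V W, hQ0 U (Γ z V W), hQ0 V (Γ z U W), map_sub, map_sub,
    ← sub_eq_zero] at h
  simp only [christoffelCurvature, map_sub, map_add]
  rw [← sub_eq_zero, ← h]
  abel

end ChristoffelTransformation

section ConeMetric

variable {X E F : Type*} [NormedAddCommGroup X] [NormedSpace ℝ X]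
  [NormedAddCommGroup E] [InnerProductSpace ℝ E]
  [NormedAddCommGroup F] [InnerProductSpace ℝ F]

theorem hasFDerivAt_smul_const_add {Y : Type*} [NormedAddCommGroup Y] [NormedSpace ℝ Y]
    {c : X → ℝ} {c' : X →L[ℝ] ℝ} {z : X} (hc : HasFDerivAt c c' z) (a b : Y) :
    HasFDerivAt (fun w => c w • a + b) (c'.smulRight a) z :=
  (hc.smul_const a).add_const b

theorem hasFDerivAt_smul_clm {Y : Type*} [NormedAddCommGroup Y] [NormedSpace ℝ Y]
    {c : X → ℝ} {c' : X →L[ℝ] ℝ} {z : X} (hc : HasFDerivAt c c' z) (B : X →L[ℝ] Y) :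
    HasFDerivAt (fun w => c w • B w) (c z • B + c'.smulRight (B z)) z :=
  hc.smul B.hasFDerivAt

/-- The pullback of the inner product along a continuous linear map. -/
def pullbackInner (P : X →L[ℝ] E) : X →L[ℝ] X →L[ℝ] ℝ :=
  (innerSL ℝ).bilinearComp P P

theorem pullbackInner_apply (P : X →L[ℝ] E) (U V : X) : pullbackInner P U V = ⟪P U, P V⟫ := by
  simp [pullbackInner]

/-- The metric `(α+1)²|x|^{2α}|dx|² + |dy|²`, where `x = P z` and `y = S z`. -/
def coneMetric (α : ℝ) (P : X →L[ℝ] E) (S : X →L[ℝ] F) (z : X) : X →L[ℝ] X →L[ℝ] ℝ :=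
  ((α + 1) ^ 2 * ‖P z‖ ^ (2 * α)) • pullbackInner P + pullbackInner S

theorem coneMetric_apply (α : ℝ) (P : X →L[ℝ] E) (S : X →L[ℝ] F) (z U V : X) :
    coneMetric α P S z U V = (α + 1) ^ 2 * ‖P z‖ ^ (2 * α) * ⟪P U, P V⟫ + ⟪S U, S V⟫ := by
  simp [coneMetric, pullbackInner_apply]

theorem hasFDerivAt_norm_rpow_of_ne_zero (a : ℝ) {x : E} (hx : x ≠ 0) :
    HasFDerivAt (fun x : E => ‖x‖ ^ (2 * a))
      ((2 * a * ‖x‖ ^ (2 * a) * (‖x‖ ^ 2)⁻¹) • innerSL ℝ x) x := by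
  have h := ((hasFDerivAt_id x).norm_sq).rpow_const (p := a) (Or.inl (by simpa using hx))
  convert! h using 1
  · ext y
    simp [Real.rpow_mul]
  · ext y
    have : 0 < ‖x‖ ^ 2 := by positivity
    simp [Real.rpow_sub_one this.ne', Real.rpow_mul]
    ring

theorem hasFDerivAt_coneMetric (α : ℝ) (P : X →L[ℝ] E) (S : X →L[ℝ] F) {z : X} (hz : P z ≠ 0) :
    HasFDerivAt (coneMetric α P S)
      (((α + 1) ^ 2 • ((2 * α * ‖P z‖ ^ (2 * α) * (‖P z‖ ^ 2)⁻¹) •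
        innerSL ℝ (P z)).comp P).smulRight (pullbackInner P)) z := by
  have h1 : HasFDerivAt (fun z : X => ‖P z‖ ^ (2 * α)) _ z :=
    (hasFDerivAt_norm_rpow_of_ne_zero α hz).comp z P.hasFDerivAt
  exact hasFDerivAt_smul_const_add (Y := X →L[ℝ] X →L[ℝ] ℝ) (h1.const_mul ((α + 1) ^ 2)) _ _

/-- The trilinear map `(x, U, V) ↦ ⟨x, V⟩ U + ⟨x, U⟩ V - ⟨U, V⟩ x` on `E`, transported to `X` along
`P : X → E` and `ι : E → X`. -/
def coneSymbol (P : X →L[ℝ] E) (ι : E →L[ℝ] X) : X →L[ℝ] X →L[ℝ] X →L[ℝ] X :=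
  letI T : X →L[ℝ] X →L[ℝ] X →L[ℝ] X :=
    ((ContinuousLinearMap.compL ℝ X X (X →L[ℝ] X)).flip (ι.comp P)).comp
      ((ContinuousLinearMap.smulRightL ℝ X X).comp (pullbackInner P))
  T + (ContinuousLinearMap.flipₗᵢ ℝ X X X).toContinuousLinearEquiv.toContinuousLinearMap.comp T
    - T.flip

theorem coneSymbol_apply (P : X →L[ℝ] E) (ι : E →L[ℝ] X) (x U V : X) :
    coneSymbol P ι x U V = ι (⟪P x, P V⟫ • P U + ⟪P x, P U⟫ • P V - ⟪P U, P V⟫ • P x) := by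
  simp [coneSymbol, pullbackInner_apply]

/-- The Christoffel map of `coneMetric α P S`. -/
def coneChristoffel (α : ℝ) (P : X →L[ℝ] E) (ι : E →L[ℝ] X) (z : X) : X →L[ℝ] X →L[ℝ] X :=
  (α * (‖P z‖ ^ 2)⁻¹) • coneSymbol P ι z

theorem coneChristoffel_apply (α : ℝ) (P : X →L[ℝ] E) (ι : E →L[ℝ] X) (z U V : X) :
    coneChristoffel α P ι z U V = ι ((α * (‖P z‖ ^ 2)⁻¹) •
      (⟪P z, P V⟫ • P U + ⟪P z, P U⟫ • P V - ⟪P U, P V⟫ • P z)) := by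
  rw [map_smul, ← coneSymbol_apply]
  simp [coneChristoffel]

theorem coneChristoffel_comm (α : ℝ) (P : X →L[ℝ] E) (ι : E →L[ℝ] X) (z U V : X) :
    coneChristoffel α P ι z U V = coneChristoffel α P ι z V U := by
  rw [coneChristoffel_apply, coneChristoffel_apply, real_inner_comm (P U) (P V),
    add_comm (⟪P z, P V⟫ • _)]

theorem fderiv_coneMetric_apply (α : ℝ) {P : X →L[ℝ] E} {S : X →L[ℝ] F} {ι : E →L[ℝ] X}
    (hP : ∀ x, P (ι x) = x) (hS : ∀ x, S (ι x) = 0) {z : X} (hz : P z ≠ 0) (W U V : X) :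
    fderiv ℝ (coneMetric α P S) z W U V =
      coneMetric α P S z (coneChristoffel α P ι z W U) V
        + coneMetric α P S z U (coneChristoffel α P ι z W V) := by
  rw [(hasFDerivAt_coneMetric α P S hz).fderiv]
  simp only [coneMetric_apply, coneChristoffel_apply, hP, hS, inner_add_left, inner_sub_left,
    inner_add_right, inner_sub_right, real_inner_smul_left, real_inner_smul_right]
  simp [pullbackInner_apply]
  rw [real_inner_comm (P z) (P U), real_inner_comm (P W) (P U)]
  ring

theorem hasFDerivAt_coneChristoffel (α : ℝ) (P : X →L[ℝ] E) (ι : E →L[ℝ] X) {z : X}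
    (hz : P z ≠ 0) :
    HasFDerivAt (coneChristoffel α P ι)
      ((α * (‖P z‖ ^ 2)⁻¹) • coneSymbol P ι +
        (α • (-((‖P z‖ ^ 2) ^ 2)⁻¹ • (2 • (innerSL ℝ (P z)).comp P))).smulRight
          (coneSymbol P ι z)) z := by
  have h1 : HasFDerivAt (fun z : X => ‖P z‖ ^ 2) (2 • (innerSL ℝ (P z)).comp P) z :=
    P.hasFDerivAt.norm_sq
  have h2 : HasFDerivAt (fun z : X => (‖P z‖ ^ 2)⁻¹) _ z :=
    (hasDerivAt_inv (x := ‖P z‖ ^ 2) (by simpa using hz)).comp_hasFDerivAt z h1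
  have h3 := h2.const_mul α
  generalize hB : coneSymbol P ι = B
  have h4 : coneChristoffel α P ι = fun z => (α * (‖P z‖ ^ 2)⁻¹) • B z := by
    rw [← hB]; rfl
  rw [h4]
  exact hasFDerivAt_smul_clm (Y := X →L[ℝ] X →L[ℝ] X) h3 B

theorem christoffelCurvature_coneChristoffel (α : ℝ) {P : X →L[ℝ] E} {ι : E →L[ℝ] X}
    (hP : ∀ x, P (ι x) = x) {z : X} (hz : P z ≠ 0) (U V W : X) :
    christoffelCurvature (coneChristoffel α P ι) z U V W =
      ι ((-(α * (α + 2)) * (‖P z‖ ^ 2)⁻¹) •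
        ((⟪P V, P W⟫ - ⟪P z, P V⟫ * ⟪P z, P W⟫ * (‖P z‖ ^ 2)⁻¹) •
            (P U - (⟪P z, P U⟫ * (‖P z‖ ^ 2)⁻¹) • P z)
          - (⟪P U, P W⟫ - ⟪P z, P U⟫ * ⟪P z, P W⟫ * (‖P z‖ ^ 2)⁻¹) •
            (P V - (⟪P z, P V⟫ * (‖P z‖ ^ 2)⁻¹) • P z))) := by
  have hz' : ‖P z‖ ≠ 0 := by simpa using hz
  rw [christoffelCurvature, (hasFDerivAt_coneChristoffel α P ι hz).fderiv]
  simp only [coneChristoffel_apply, hP]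
  simp only [add_apply, smul_apply, ContinuousLinearMap.smulRight_apply, coneSymbol_apply,
    ← map_smul ι, ← map_add ι, ← map_sub ι]
  refine congrArg ι ?_
  simp only [inner_add_right, inner_sub_right, real_inner_smul_right, real_inner_self_eq_norm_sq]
  simp only [ContinuousLinearMap.comp_apply, innerSL_apply_apply, smul_eq_mul, nsmul_eq_mul]
  rw [real_inner_comm (P z) (P U), real_inner_comm (P z) (P V), real_inner_comm (P U) (P V)]
  match_scalars <;> field_simp <;> ring

end ConeMetric

section TransverseCurvature

variable {E F : Type*} [NormedAddCommGroup E] [InnerProductSpace ℝ E]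
  [NormedAddCommGroup F] [InnerProductSpace ℝ F]

/-- Up to the sign and the scale of the metric, the curvature operator of the sphere through `x`,
extended by zero to the radial direction. -/
def sphereCurvature (x u v w : E) : E :=
  (‖x‖ ^ 2)⁻¹ •
    ((⟪v, w⟫ - ⟪x, v⟫ * ⟪x, w⟫ * (‖x‖ ^ 2)⁻¹) • (u - (⟪x, u⟫ * (‖x‖ ^ 2)⁻¹) • x)
      - (⟪u, w⟫ - ⟪x, u⟫ * ⟪x, w⟫ * (‖x‖ ^ 2)⁻¹) • (v - (⟪x, v⟫ * (‖x‖ ^ 2)⁻¹) • x))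

theorem inner_sphereCurvature {x : E} (hx : x ≠ 0) (u v w : E) :
    ⟪x, sphereCurvature x u v w⟫ = 0 := by
  have : ‖x‖ ≠ 0 := by simpa using hx
  simp only [sphereCurvature, inner_sub_right, real_inner_smul_right, real_inner_self_eq_norm_sq]
  field_simp
  ring

theorem sphereCurvature_of_orthogonal {x u v : E} (hxv : ⟪x, v⟫ = 0) (huv : ⟪u, v⟫ = 0) :
    sphereCurvature x u v v =
      ((‖x‖ ^ 2)⁻¹ * ‖v‖ ^ 2) • (u - (⟪x, u⟫ * (‖x‖ ^ 2)⁻¹) • x) := by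
  simp [sphereCurvature, hxv, huv, mul_smul]

theorem sphereCurvature_smul_left {x : E} (hx : x ≠ 0) (t : ℝ) (v w : E) :
    sphereCurvature x (t • x) v w = 0 := by
  have : ‖x‖ ≠ 0 := by simpa using hx
  simp only [sphereCurvature, real_inner_smul_right, real_inner_smul_left,
    real_inner_self_eq_norm_sq]
  match_scalars <;> field_simp <;> ring

theorem exists_ne_zero_inner_eq_zero [FiniteDimensional ℝ E] (hE : 3 ≤ Module.finrank ℝ E)
    (a b : E) : ∃ s : E, s ≠ 0 ∧ ⟪a, s⟫ = 0 ∧ ⟪b, s⟫ = 0 := by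
  have h := LinearMap.ker_ne_bot_of_finrank_lt
    (f := ((innerSL ℝ a).prod (innerSL ℝ b)).toLinearMap) (by simp; omega)
  obtain ⟨s, hs, hs0⟩ := Submodule.exists_mem_ne_zero_of_ne_bot h
  exact ⟨s, hs0, by simpa using hs⟩

variable [FiniteDimensional ℝ E] {L : E × F →L[ℝ] E × F} {x x' : E} {c c' : ℝ}

theorem map_spherical (hE : 3 ≤ Module.finrank ℝ E) (hx : x ≠ 0) (hx' : x' ≠ 0)
    (hcurv : ∀ U V W, L (sphereCurvature x U.1 V.1 W.1, 0) =
      (sphereCurvature x' (L U).1 (L V).1 (L W).1, 0))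
    {s : E} (hs : ⟪x, s⟫ = 0) : (L (s, 0)).2 = 0 ∧ ⟪x', (L (s, 0)).1⟫ = 0 := by
  obtain ⟨v, hv, hxv, hsv⟩ := exists_ne_zero_inner_eq_zero hE x s
  have h := hcurv (s, 0) (v, 0) (v, 0)
  set k := (‖x‖ ^ 2)⁻¹ * ‖v‖ ^ 2 with hk
  have hk0 : k ≠ 0 := by simp [hk, hx, hv]
  have hsm : ((k • s, 0) : E × F) = k • (s, 0) := by simp
  rw [sphereCurvature_of_orthogonal hxv hsv, hs, zero_mul, zero_smul, sub_zero, ← hk, hsm,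
    map_smul] at h
  have h1 := congrArg Prod.fst h
  have h2 := congrArg Prod.snd h
  simp only [Prod.smul_fst, Prod.smul_snd] at h1 h2
  refine ⟨(smul_eq_zero.1 h2).resolve_left hk0, ?_⟩
  have h3 := inner_sphereCurvature hx' (L (s, 0)).1 (L (v, 0)).1 (L (v, 0)).1
  rw [← h1, real_inner_smul_right] at h3
  exact (mul_eq_zero.1 h3).resolve_left hk0

theorem conformal_factor_mul_norm_sq (hE : 3 ≤ Module.finrank ℝ E) (hx : x ≠ 0) (hx' : x' ≠ 0)
    (hc : 0 < c) (hc' : 0 < c')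
    (hiso : ∀ U V, c' * ⟪(L U).1, (L V).1⟫ + ⟪(L U).2, (L V).2⟫ = c * ⟪U.1, V.1⟫ + ⟪U.2, V.2⟫)
    (hcurv : ∀ U V W, L (sphereCurvature x U.1 V.1 W.1, 0) =
      (sphereCurvature x' (L U).1 (L V).1 (L W).1, 0)) :
    c' * ‖x'‖ ^ 2 = c * ‖x‖ ^ 2 := by
  obtain ⟨s, hs, hxs, -⟩ := exists_ne_zero_inner_eq_zero hE x x
  obtain ⟨v, hv, hxv, hsv⟩ := exists_ne_zero_inner_eq_zero hE x s
  obtain ⟨hs2, hs1⟩ := map_spherical hE hx hx' hcurv hxs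
  obtain ⟨hv2, hv1⟩ := map_spherical hE hx hx' hcurv hxv
  have hsv' : ⟪(L (s, 0)).1, (L (v, 0)).1⟫ = 0 := by
    have h := hiso (s, 0) (v, 0)
    simp only [hs2, hv2, hsv, inner_zero_left, mul_zero, add_zero, mul_eq_zero] at h
    exact h.resolve_left hc'.ne'
  have hss : c' * ‖(L (s, 0)).1‖ ^ 2 = c * ‖s‖ ^ 2 := by
    simpa [hs2] using hiso (s, 0) (s, 0)
  have hvv : c' * ‖(L (v, 0)).1‖ ^ 2 = c * ‖v‖ ^ 2 := by
    simpa [hv2] using hiso (v, 0) (v, 0)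
  have hs0 : (L (s, 0)).1 ≠ 0 := by
    intro h0
    rw [h0] at hss
    have : 0 < c * ‖s‖ ^ 2 := by positivity
    simp at hss
    simp_all
  have h := hcurv (s, 0) (v, 0) (v, 0)
  rw [sphereCurvature_of_orthogonal hxv hsv, sphereCurvature_of_orthogonal hv1 hsv', hxs, hs1,
    zero_mul, zero_smul, sub_zero, zero_mul, zero_smul, sub_zero] at h
  have hsm : ((((‖x‖ ^ 2)⁻¹ * ‖v‖ ^ 2) • s, 0) : E × F) = ((‖x‖ ^ 2)⁻¹ * ‖v‖ ^ 2) • (s, 0) := by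
    simp
  rw [hsm, map_smul] at h
  have h1 := smul_left_injective ℝ hs0 (congrArg Prod.fst h)
  have hnx : ‖x‖ ≠ 0 := by simpa using hx
  have hnx' : ‖x'‖ ≠ 0 := by simpa using hx'
  have hnv : ‖v‖ ^ 2 ≠ 0 := by simpa using hv
  have h2 : ‖v‖ ^ 2 * ‖x'‖ ^ 2 = ‖(L (v, 0)).1‖ ^ 2 * ‖x‖ ^ 2 := by
    field_simp at h1
    linarith
  apply mul_left_cancel₀ hnv
  linear_combination c' * h2 + ‖x‖ ^ 2 * hvv

theorem map_radial [FiniteDimensional ℝ F] (hE : 3 ≤ Module.finrank ℝ E)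
    (hx : x ≠ 0) (hx' : x' ≠ 0) (hc : 0 < c)
    (hiso : ∀ U V, c' * ⟪(L U).1, (L V).1⟫ + ⟪(L U).2, (L V).2⟫ = c * ⟪U.1, V.1⟫ + ⟪U.2, V.2⟫)
    (hcurv : ∀ U V W, L (sphereCurvature x U.1 V.1 W.1, 0) =
      (sphereCurvature x' (L U).1 (L V).1 (L W).1, 0))
    (hnorm : ‖x'‖ = ‖x‖) (hrad : ∀ U, ⟪x', (L U).1⟫ = ⟪x, U.1⟫) (t : ℝ) (w : F) :
    (L (t • x, w)).1 = t • x' := by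
  have hinj : Function.Injective L := by
    rw [injective_iff_map_eq_zero]
    intro U hU
    have h := hiso U U
    simp only [hU, Prod.fst_zero, Prod.snd_zero, inner_zero_left, mul_zero, add_zero,
      real_inner_self_eq_norm_sq] at h
    have h1 : 0 ≤ c * ‖U.1‖ ^ 2 := by positivity
    have h2 : c * ‖U.1‖ ^ 2 = 0 := by linarith [sq_nonneg ‖U.2‖]
    have h3 : ‖U.2‖ ^ 2 = 0 := by linarith
    exact Prod.ext (by simpa [hc.ne'] using h2) (by simpa using h3)
  have hsurj : Function.Surjective L :=
    LinearMap.injective_iff_surjective (f := L.toLinearMap).1 hinj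
  obtain ⟨v, hv, hxv, hav⟩ := exists_ne_zero_inner_eq_zero hE x' (L (t • x, w)).1
  obtain ⟨Y, hY⟩ := hsurj (v, 0)
  have h := congrArg Prod.fst (hcurv (t • x, w) Y Y)
  rw [sphereCurvature_smul_left hx, hY, sphereCurvature_of_orthogonal hxv hav, hrad,
    Prod.mk_zero_zero, map_zero] at h
  have hk : (‖x'‖ ^ 2)⁻¹ * ‖v‖ ^ 2 ≠ 0 := by simp [hx', hv]
  have h' := sub_eq_zero.1 ((smul_eq_zero.1 h.symm).resolve_left hk)
  have hnx : ‖x‖ ≠ 0 := by simpa using hx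
  rw [h', hnorm, real_inner_smul_right, real_inner_self_eq_norm_sq]
  congr 1
  field_simp

/-- An infinitesimal isometry which preserves the curvature and the radial covector is block
diagonal and maps the radial vector to the radial vector. -/
theorem block_diagonal [FiniteDimensional ℝ F] (hE : 3 ≤ Module.finrank ℝ E)
    (hx : x ≠ 0) (hx' : x' ≠ 0) (hc : 0 < c)
    (hiso : ∀ U V, c * ⟪(L U).1, (L V).1⟫ + ⟪(L U).2, (L V).2⟫ = c * ⟪U.1, V.1⟫ + ⟪U.2, V.2⟫)
    (hcurv : ∀ U V W, L (sphereCurvature x U.1 V.1 W.1, 0) =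
      (sphereCurvature x' (L U).1 (L V).1 (L W).1, 0))
    (hnorm : ‖x'‖ = ‖x‖) (hrad : ∀ U, ⟪x', (L U).1⟫ = ⟪x, U.1⟫) :
    (∀ u, (L (u, 0)).2 = 0) ∧ (∀ w, (L (0, w)).1 = 0) ∧ (L (x, 0)).1 = x' := by
  have hr := map_radial hE hx hx' hc hiso hcurv hnorm hrad
  have hx1 : (L (x, 0)).1 = x' := by simpa using hr 1 0
  have hx2 : (L (x, 0)).2 = 0 := by
    have h := hiso (x, 0) (x, 0)
    simp only [hx1, real_inner_self_eq_norm_sq, hnorm, norm_zero] at h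
    have : ‖(L (x, 0)).2‖ ^ 2 = 0 := by linarith
    simpa using this
  refine ⟨fun u => ?_, fun w => by simpa using hr 0 w, hx1⟩
  have hnx : ‖x‖ ≠ 0 := by simpa using hx
  set t := ⟪x, u⟫ * (‖x‖ ^ 2)⁻¹ with ht
  have horth : ⟪x, u - t • x⟫ = 0 := by
    rw [inner_sub_right, real_inner_smul_right, real_inner_self_eq_norm_sq, ht]
    field_simp
    ring
  have hdec : ((u, 0) : E × F) = (u - t • x, 0) + t • (x, 0) := by simp
  rw [hdec, map_add, map_smul, Prod.snd_add, Prod.smul_snd, hx2,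
    (map_spherical hE hx hx' hcurv horth).1, smul_zero, add_zero]

end TransverseCurvature

section LocalIsometry

theorem coneFactor_pos {E : Type*} [NormedAddCommGroup E] {α : ℝ} (hα : 0 < α) {x : E}
    (hx : x ≠ 0) : 0 < (α + 1) ^ 2 * ‖x‖ ^ (2 * α) := by
  positivity

variable {E F : Type*} [NormedAddCommGroup E] [InnerProductSpace ℝ E]
  [NormedAddCommGroup F] [InnerProductSpace ℝ F]
  {α : ℝ} {f : E × F → E × F} {z : E × F}

open ContinuousLinearMap (fst snd inl inr)

/-- `f` is, at `z`, an isometry of the metric `(α+1)²|x|^{2α}|dx|² + |dy|²` off its singular set. -/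
def IsConeIsometryAt (α : ℝ) (f : E × F → E × F) (z : E × F) : Prop :=
  z.1 ≠ 0 ∧ (f z).1 ≠ 0 ∧ ∀ U V,
    (α + 1) ^ 2 * ‖(f z).1‖ ^ (2 * α) * ⟪(fderiv ℝ f z U).1, (fderiv ℝ f z V).1⟫
        + ⟪(fderiv ℝ f z U).2, (fderiv ℝ f z V).2⟫ =
      (α + 1) ^ 2 * ‖z.1‖ ^ (2 * α) * ⟪U.1, V.1⟫ + ⟪U.2, V.2⟫

theorem coneMetric_nondegenerate (hα : 0 < α) {z : E × F} (hz : z.1 ≠ 0) {U : E × F}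
    (h : ∀ V, coneMetric α (fst ℝ E F) (snd ℝ E F) z U V = 0) : U = 0 := by
  have hc := coneFactor_pos hα hz
  have h := h U
  simp only [coneMetric_apply, ContinuousLinearMap.coe_fst', ContinuousLinearMap.coe_snd',
    real_inner_self_eq_norm_sq] at h
  have h1 : 0 ≤ (α + 1) ^ 2 * ‖z.1‖ ^ (2 * α) * ‖U.1‖ ^ 2 := by positivity
  have h2 : (α + 1) ^ 2 * ‖z.1‖ ^ (2 * α) * ‖U.1‖ ^ 2 = 0 := by linarith [sq_nonneg ‖U.2‖]
  have h3 : ‖U.2‖ ^ 2 = 0 := by linarith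
  exact Prod.ext (by simpa using (mul_eq_zero.1 h2).resolve_left hc.ne') (by simpa using h3)

theorem inner_fderiv_fst_of_norm_fst (hf : DifferentiableAt ℝ f z)
    (hnorm : ∀ᶠ w in nhds z, ‖(f w).1‖ = ‖w.1‖) (U : E × F) :
    ⟪(f z).1, (fderiv ℝ f z U).1⟫ = ⟪z.1, U.1⟫ := by
  have h1 : HasFDerivAt (fun w => ‖(f w).1‖ ^ 2) _ z := hf.hasFDerivAt.fst.norm_sq
  have h2 : HasFDerivAt (fun w : E × F => ‖w.1‖ ^ 2) _ z :=
    (hasFDerivAt_id z).fst.norm_sq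
  have h3 := h1.congr_of_eventuallyEq (f₁ := fun w : E × F => ‖w.1‖ ^ 2)
    (hnorm.mono fun w hw => by simp only [hw])
  simpa using DFunLike.congr_fun (h3.unique h2) U

variable [FiniteDimensional ℝ E] [FiniteDimensional ℝ F]

theorem fderiv_fderiv_of_isConeIsometryAt (hα : 0 < α) (hf : ContDiffAt ℝ 2 f z)
    (hiso : ∀ᶠ w in nhds z, IsConeIsometryAt α f w) (U V : E × F) :
    fderiv ℝ (fderiv ℝ f) z U V =
      fderiv ℝ f z (coneChristoffel α (fst ℝ E F) (inl ℝ E F) z U V)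
        - coneChristoffel α (fst ℝ E F) (inl ℝ E F) (f z) (fderiv ℝ f z U) (fderiv ℝ f z V) := by
  obtain ⟨hz, hz', -⟩ := hiso.self_of_nhds
  refine fderiv_fderiv_of_isometry (g := coneMetric α (fst ℝ E F) (snd ℝ E F)) hf
    (hasFDerivAt_coneMetric α _ _ hz).differentiableAt
    (hasFDerivAt_coneMetric α _ _ hz').differentiableAt
    (fderiv_coneMetric_apply α (fun _ => rfl) (fun _ => rfl) hz)
    (fderiv_coneMetric_apply α (fun _ => rfl) (fun _ => rfl) hz')
    (coneChristoffel_comm α _ _ z) (coneChristoffel_comm α _ _ (f z)) (fun U V => ?_)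
    (fun U => coneMetric_nondegenerate hα hz) (fun U => coneMetric_nondegenerate hα hz') ?_ U V
  · simp only [coneMetric_apply, real_inner_comm]
  · filter_upwards [hiso] with w hw U V
    rw [coneMetric_apply, coneMetric_apply]
    exact hw.2.2 U V

theorem map_sphereCurvature_of_isConeIsometryAt (hα : 0 < α) (hf : ContDiffAt ℝ 3 f z)
    (hiso : ∀ᶠ w in nhds z, IsConeIsometryAt α f w) (U V W : E × F) :
    fderiv ℝ f z (sphereCurvature z.1 U.1 V.1 W.1, 0) =
      (sphereCurvature (f z).1 (fderiv ℝ f z U).1 (fderiv ℝ f z V).1 (fderiv ℝ f z W).1, 0) := by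
  obtain ⟨hz, hz', -⟩ := hiso.self_of_nhds
  have key (y : E × F) (hy : y.1 ≠ 0) (U V W : E × F) :
      christoffelCurvature (coneChristoffel α (fst ℝ E F) (inl ℝ E F)) y U V W =
        (-(α * (α + 2))) • (sphereCurvature y.1 U.1 V.1 W.1, (0 : F)) := by
    rw [christoffelCurvature_coneChristoffel α (fun _ => rfl) hy]
    simp [sphereCurvature, mul_smul]
  have h := map_christoffelCurvature (Γ := coneChristoffel α (fst ℝ E F) (inl ℝ E F)) hf
    (hasFDerivAt_coneChristoffel α _ _ hz).differentiableAt
    (hasFDerivAt_coneChristoffel α _ _ hz').differentiableAt ?_ U V W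
  · rw [key z hz, key (f z) hz', map_smul] at h
    exact smul_right_injective _ (neg_ne_zero.2 (by positivity)) h
  · filter_upwards [hiso.eventually_nhds,
      (hf.of_le (by norm_num : (2 : WithTop ℕ∞) ≤ 3)).eventually (by simp)] with w hw hfw
    exact fderiv_fderiv_of_isConeIsometryAt hα hfw hw

theorem norm_fst_of_isConeIsometryAt (hα : 0 < α) (hE : 3 ≤ Module.finrank ℝ E)
    (hf : ContDiffAt ℝ 3 f z) (hiso : ∀ᶠ w in nhds z, IsConeIsometryAt α f w) :
    ‖(f z).1‖ = ‖z.1‖ := by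
  obtain ⟨hz, hz', hz''⟩ := hiso.self_of_nhds
  have h := conformal_factor_mul_norm_sq hE hz hz' (coneFactor_pos hα hz) (coneFactor_pos hα hz')
    hz'' (map_sphereCurvature_of_isConeIsometryAt hα hf hiso)
  have hpow (x : E) (hx : x ≠ 0) : (α + 1) ^ 2 * ‖x‖ ^ (2 * α) * ‖x‖ ^ 2 =
      (α + 1) ^ 2 * ‖x‖ ^ (2 * α + 2) := by
    rw [Real.rpow_add (norm_pos_iff.2 hx), mul_assoc, Real.rpow_two]
  rw [hpow _ hz, hpow _ hz'] at h
  exact (Real.rpow_left_inj (norm_nonneg _) (norm_nonneg _) (by positivity)).1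
    (mul_left_cancel₀ (by positivity) h)

theorem block_diagonal_of_isConeIsometryAt (hα : 0 < α) (hE : 3 ≤ Module.finrank ℝ E)
    (hf : ContDiffAt ℝ 3 f z) (hiso : ∀ᶠ w in nhds z, IsConeIsometryAt α f w) :
    (∀ u, (fderiv ℝ f z (u, 0)).2 = 0) ∧ (∀ w, (fderiv ℝ f z (0, w)).1 = 0) ∧
      (fderiv ℝ f z (z.1, 0)).1 = (f z).1 := by
  obtain ⟨hz, hz', hz''⟩ := hiso.self_of_nhds
  have hnorm : ∀ᶠ w in nhds z, ‖(f w).1‖ = ‖w.1‖ := by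
    filter_upwards [hiso.eventually_nhds, hf.eventually (by simp)] with w hw hfw
    exact norm_fst_of_isConeIsometryAt hα hE hfw hw
  refine block_diagonal hE hz hz' (coneFactor_pos hα hz) (fun U V => ?_)
    (map_sphereCurvature_of_isConeIsometryAt hα hf hiso) hnorm.self_of_nhds
    (inner_fderiv_fst_of_norm_fst (hf.differentiableAt (by simp)) hnorm)
  simpa only [hnorm.self_of_nhds] using hz'' U V

theorem inner_fderiv_of_isConeIsometryAt (hα : 0 < α) (hE : 3 ≤ Module.finrank ℝ E)
    (hf : ContDiffAt ℝ 3 f z) (hiso : ∀ᶠ w in nhds z, IsConeIsometryAt α f w) (u v : E) :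
    ⟪(fderiv ℝ f z (u, 0)).1, (fderiv ℝ f z (v, 0)).1⟫ = ⟪u, v⟫ := by
  obtain ⟨hz, -, hz''⟩ := hiso.self_of_nhds
  obtain ⟨h1, -, -⟩ := block_diagonal_of_isConeIsometryAt hα hE hf hiso
  have h := hz'' (u, 0) (v, 0)
  rw [norm_fst_of_isConeIsometryAt hα hE hf hiso, h1, h1] at h
  simpa only [inner_zero_left, add_zero, mul_right_inj' (coneFactor_pos hα hz).ne'] using h

theorem fderiv_fderiv_eq_zero_of_isConeIsometryAt (hα : 0 < α) (hE : 3 ≤ Module.finrank ℝ E)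
    (hf : ContDiffAt ℝ 3 f z) (hiso : ∀ᶠ w in nhds z, IsConeIsometryAt α f w) :
    fderiv ℝ (fderiv ℝ f) z = 0 := by
  obtain ⟨h1, h2, h3⟩ := block_diagonal_of_isConeIsometryAt hα hE hf hiso
  have hin := inner_fderiv_of_isConeIsometryAt hα hE hf hiso
  have hnorm := norm_fst_of_isConeIsometryAt hα hE hf hiso
  have hfst (U : E × F) : (fderiv ℝ f z U).1 = (fderiv ℝ f z (U.1, 0)).1 := by
    conv_lhs => rw [show U = (U.1, 0) + (0, U.2) by simp, map_add]
    simp [h2]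
  refine ContinuousLinearMap.ext fun U => ContinuousLinearMap.ext fun V => ?_
  rw [fderiv_fderiv_of_isConeIsometryAt hα (hf.of_le (by norm_num)) hiso, coneChristoffel_apply,
    coneChristoffel_apply]
  simp only [ContinuousLinearMap.coe_fst', ContinuousLinearMap.inl_apply, hfst U, hfst V, ← h3, hin]
  rw [h3, hnorm]
  set k := α * (‖z.1‖ ^ 2)⁻¹
  have hT (w : E) : fderiv ℝ f z (w, 0) = ((fderiv ℝ f z ∘L inl ℝ E F) w |>.1, 0) :=
    Prod.ext rfl (h1 w)
  rw [hT, ← h3]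
  simp only [hT, map_smul, map_add, map_sub, Prod.smul_fst, Prod.fst_add, Prod.fst_sub, sub_self]
  simp

theorem eqOn_linearIsometryEquiv_of_isConeIsometryAt (hα : 0 < α) (hE : 3 ≤ Module.finrank ℝ E)
    {Ω : Set (E × F)} (hΩo : IsOpen Ω) (hΩc : IsConnected Ω) (hf : ContDiffOn ℝ 3 f Ω)
    (hiso : ∀ z ∈ Ω, IsConeIsometryAt α f z) :
    ∃ (A : E ≃ₗᵢ[ℝ] E) (B : F ≃ₗᵢ[ℝ] F) (b : F), ∀ z ∈ Ω, f z = (A z.1, B z.2 + b) := by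
  have hfz z (hz : z ∈ Ω) : ContDiffAt ℝ 3 f z := hf.contDiffAt (hΩo.mem_nhds hz)
  have hisoz z (hz : z ∈ Ω) : ∀ᶠ w in nhds z, IsConeIsometryAt α f w :=
    Filter.mem_of_superset (hΩo.mem_nhds hz) hiso
  have hd : DifferentiableOn ℝ (fderiv ℝ f) Ω := fun z hz =>
    (((hfz z hz).fderiv_right (m := 1) (by norm_num)).differentiableAt
      (by simp)).differentiableWithinAt
  obtain ⟨z₀, hz₀⟩ := hΩc.nonempty
  set L := fderiv ℝ f z₀ with hL
  have hconst z (hz : z ∈ Ω) : fderiv ℝ f z = L :=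
    hΩo.is_const_of_fderiv_eq_zero (𝕜 := ℝ) hΩc.isPreconnected hd
      (fun z hz => fderiv_fderiv_eq_zero_of_isConeIsometryAt hα hE (hfz z hz) (hisoz z hz)) hz hz₀
  obtain ⟨h1, h2, -⟩ := block_diagonal_of_isConeIsometryAt hα hE (hfz z₀ hz₀) (hisoz z₀ hz₀)
  rw [← hL] at h1 h2
  obtain ⟨a, ha⟩ := hΩo.exists_eq_add_of_fderiv_eq hΩc.isPreconnected
    (hf.differentiableOn (by simp)) L.differentiable.differentiableOn
    (fun z hz => (hconst z hz).trans L.fderiv.symm)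
  let A : E →ₗᵢ[ℝ] E := ((fst ℝ E F ∘L L ∘L inl ℝ E F).toLinearMap).isometryOfInner
    (inner_fderiv_of_isConeIsometryAt hα hE (hfz z₀ hz₀) (hisoz z₀ hz₀))
  let B : F →ₗᵢ[ℝ] F := ((snd ℝ E F ∘L L ∘L inr ℝ E F).toLinearMap).isometryOfInner
    (fun u v => by
      have h := (hiso z₀ hz₀).2.2 (0, u) (0, v)
      rw [← hL, h2, h2] at h
      simpa using h)
  refine ⟨A.toLinearIsometryEquiv rfl, B.toLinearIsometryEquiv rfl, a.2, fun z hz => Prod.ext ?_ ?_⟩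
  · obtain ⟨-, -, h3⟩ := block_diagonal_of_isConeIsometryAt hα hE (hfz z hz) (hisoz z hz)
    rw [← h3, hconst z hz]
    rfl
  · have h4 : (L z).2 = (L (0, z.2)).2 := by
      conv_lhs => rw [show z = (z.1, 0) + (0, z.2) by simp, map_add, Prod.snd_add, h1, zero_add]
    rw [ha hz]
    simp [B, h4]

end LocalIsometry

/-- classification of local isometries of `(M₀, g)`, `p ≥ 3`. -/
theorem grushin_isometry_classification
    (α : ℝ) (hα : 0 < α) (p q : ℕ) (hp : 3 ≤ p) (hq : 1 ≤ q)
    (Ω : Set (GVec p q)) (hΩ : Ω ⊆ GM0 p q) (hΩo : IsOpen Ω) (hΩc : IsConnected Ω)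
    (f : GVec p q → GVec p q) (hmaps : Set.MapsTo f Ω (GM0 p q))
    (hf : ContDiffOn ℝ (⊤ : ℕ∞) f Ω)
    (hiso : ∀ z ∈ Ω, ∀ U V : GVec p q,
      gMet α p q (f z).1 (fderiv ℝ f z U) (fderiv ℝ f z V) = gMet α p q z.1 U V) :
    ∃ (A : EuclideanSpace ℝ (Fin p) ≃ₗᵢ[ℝ] EuclideanSpace ℝ (Fin p))
      (B : EuclideanSpace ℝ (Fin q) ≃ₗᵢ[ℝ] EuclideanSpace ℝ (Fin q))
      (b : EuclideanSpace ℝ (Fin q)),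
      ∀ z ∈ Ω, f z = (A z.1, B z.2 + b) :=
  eqOn_linearIsometryEquiv_of_isConeIsometryAt hα (by simpa using hp) hΩo hΩc
    (hf.of_le (WithTop.coe_le_coe.2 (le_top : (3 : ℕ∞) ≤ ⊤)))
    fun z hz => ⟨hΩ hz, hmaps hz, hiso z hz⟩

end
end

section
/- Let p ≥ 3 and q ≥ 1 (so n = p + q ≥ 4). For every P ∈ M₀, the conformally invariant cone 𝒰_P := { X ∈ ℝ^{p+q} : W_P(X, Y, U, V) = 0 for all Y, U, V such that X, Y, U, V are pairwise g-orthogonal at P } satisfies 𝒰_P = T_P S ∪ T_P H, i.e. 𝒰_P consists exactly of the vectors X with |X_H| |X_S| = 0. -/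
noncomputable section

open scoped RealInnerProductSpace

theorem fderiv_gammaMap (α : ℝ) (p q : ℕ) (z : GVec p q) (hz : z.1 ≠ 0) (Y Z X : GVec p q) :
    fderiv ℝ (fun w : GVec p q => gammaMap α p q w.1 Y Z) z X =
      ((α * (⟪z.1, z.1⟫)⁻¹) • (⟪X.1, Z.1⟫ • Y.1 + ⟪X.1, Y.1⟫ • Z.1 - ⟪Y.1, Z.1⟫ • X.1)
        - (2 * α * ⟪z.1, X.1⟫ * (⟪z.1, z.1⟫ ^ 2)⁻¹) •
          (⟪z.1, Z.1⟫ • Y.1 + ⟪z.1, Y.1⟫ • Z.1 - ⟪Y.1, Z.1⟫ • z.1), 0) := by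
  have hne : ⟪z.1, z.1⟫ ≠ 0 := inner_self_ne_zero.2 hz
  have hγ : (fun w : GVec p q => gammaMap α p q w.1 Y Z) = fun w : GVec p q =>
      ((α * (⟪w.1, w.1⟫)⁻¹) • (⟪w.1, Z.1⟫ • Y.1 + ⟪w.1, Y.1⟫ • Z.1 - ⟪Y.1, Z.1⟫ • w.1), 0) := by
    funext w
    rw [gammaMap, Real.rpow_neg (norm_nonneg _), Real.rpow_two, real_inner_self_eq_norm_sq]
  have hf : HasFDerivAt (fun w : GVec p q => w.1) (ContinuousLinearMap.fst ℝ _ _) z :=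
    hasFDerivAt_fst
  have hin (c : EuclideanSpace ℝ (Fin p)) := hf.inner ℝ (hasFDerivAt_const c z)
  have hs := ((hasDerivAt_inv hne).comp_hasFDerivAt z (hf.inner ℝ hf)).const_mul α
  have hB := (((hin Z.1).smul_const Y.1).add ((hin Y.1).smul_const Z.1)).sub
    (hf.const_smul ⟪Y.1, Z.1⟫)
  have h := (hs.smul hB).prodMk (hasFDerivAt_const (0 : EuclideanSpace ℝ (Fin q)) z)
  rw [hγ]
  refine (congrArg (fun L => L X) h.fderiv).trans ?_
  refine Prod.ext ?_ (by simp)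
  simp [real_inner_comm z.1 X.1]
  module

/-- The Euclidean inner product of the vertical parts of two vectors of `ℝ^p`. -/
def vInner {p : ℕ} (x u v : EuclideanSpace ℝ (Fin p)) : ℝ :=
  ⟪u, v⟫ - ⟪u, x⟫ * ⟪v, x⟫ / ⟪x, x⟫

theorem riem_eq (α : ℝ) (p q : ℕ) (z : GVec p q) (hz : z.1 ≠ 0) (X Y U V : GVec p q) :
    riem α p q z X Y U V = (α + 1) ^ 2 * ‖z.1‖ ^ (2 * α) * (-(α * (α + 2)) / ⟪z.1, z.1⟫) *
      (vInner z.1 X.1 U.1 * vInner z.1 Y.1 V.1 - vInner z.1 X.1 V.1 * vInner z.1 Y.1 U.1) := by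
  have hne : ⟪z.1, z.1⟫ ≠ 0 := inner_self_ne_zero.2 hz
  rw [riem, curvOp, covDeriv, covDeriv, fderiv_gammaMap α p q z hz,
    fderiv_gammaMap α p q z hz, gMet]
  simp only [gammaMap, Real.rpow_neg (norm_nonneg _), Real.rpow_two, ← real_inner_self_eq_norm_sq,
    vInner, Prod.fst_add, Prod.snd_add, Prod.fst_sub, Prod.snd_sub, add_zero, sub_zero,
    inner_zero_right, inner_add_right, inner_sub_right, real_inner_smul_right]
  simp only [mul_assoc]
  congr 2
  rw [real_inner_comm Y.1 z.1, real_inner_comm U.1 z.1, real_inner_comm V.1 z.1,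
    real_inner_comm U.1 V.1, real_inner_comm Y.1 U.1, real_inner_comm Y.1 V.1]
  field_simp
  ring

theorem weyl_eq_riem_of_orthogonal (α : ℝ) (p q : ℕ) (z X Y U V : GVec p q)
    (hXU : gMet α p q z.1 X U = 0) (hXV : gMet α p q z.1 X V = 0)
    (hYU : gMet α p q z.1 Y U = 0) (hYV : gMet α p q z.1 Y V = 0) :
    weyl α p q z X Y U V = riem α p q z X Y U V := by
  simp [weyl, hXU, hXV, hYU, hYV]

theorem exists_ne_zero_orthogonal_pair {p : ℕ} (hp : 3 ≤ p) (a b : EuclideanSpace ℝ (Fin p)) :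
    ∃ f : EuclideanSpace ℝ (Fin p), f ≠ 0 ∧ ⟪a, f⟫ = 0 ∧ ⟪b, f⟫ = 0 := by
  set K := Submodule.span ℝ ({a, b} : Set (EuclideanSpace ℝ (Fin p)))
  have hK : Module.finrank ℝ K ≤ 2 := by
    classical
    refine (finrank_span_le_card _).trans ?_
    rw [Set.toFinset_card]
    simpa using Finset.card_le_two (a := a) (b := b)
  have hsum := K.finrank_add_finrank_orthogonal
  rw [finrank_euclideanSpace_fin] at hsum
  have hne : Kᗮ ≠ ⊥ := by
    intro h
    rw [h, finrank_bot] at hsum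
    omega
  obtain ⟨f, hf, hf0⟩ := Submodule.exists_mem_ne_zero_of_ne_bot hne
  exact ⟨f, hf0, hf a (Submodule.subset_span (by simp)), hf b (Submodule.subset_span (by simp))⟩

/-- Any vector `(t, w)` of `ℝ × ℝ^q` with `q ≥ 1` has a nonzero orthogonal vector, for the inner
product weighted by `m` on the first factor. -/
theorem exists_ne_zero_orthogonal_prod {q : ℕ} (hq : 1 ≤ q) {m : ℝ} (hm : 0 < m) (t : ℝ)
    (w : EuclideanSpace ℝ (Fin q)) :
    ∃ (s : ℝ) (v : EuclideanSpace ℝ (Fin q)), m * (t * s) + ⟪w, v⟫ = 0 ∧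
      0 < m * s ^ 2 + ⟪v, v⟫ := by
  by_cases hw : w = 0
  · refine ⟨0, EuclideanSpace.single ⟨0, hq⟩ 1, by simp [hw], by simp⟩
  · have h : 0 < ⟪w, w⟫ := real_inner_self_pos.2 hw
    refine ⟨⟪w, w⟫, (-(m * t)) • w, by rw [real_inner_smul_right]; ring, ?_⟩
    have := real_inner_self_nonneg (x := (-(m * t)) • w)
    positivity

theorem exists_orthogonal_riem_ne_zero (α : ℝ) (hα : 0 < α) (p q : ℕ) (hp : 3 ≤ p) (hq : 1 ≤ q)
    (z : GVec p q) (hz : z.1 ≠ 0) (X : GVec p q) (hS : X ∉ TSp p q z) (hH : X ∉ THp p q z) :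
    ∃ Y U V : GVec p q,
      gMet α p q z.1 X Y = 0 ∧ gMet α p q z.1 X U = 0 ∧ gMet α p q z.1 X V = 0 ∧
      gMet α p q z.1 Y U = 0 ∧ gMet α p q z.1 Y V = 0 ∧ gMet α p q z.1 U V = 0 ∧
      riem α p q z X Y U V ≠ 0 := by
  obtain ⟨x, y⟩ := z
  obtain ⟨X₁, w⟩ := X
  simp only at hz
  have hx : 0 < ⟪x, x⟫ := real_inner_self_pos.2 hz
  have hn : 0 < ‖x‖ := norm_pos_iff.2 hz
  obtain ⟨t, e, rfl, hex⟩ : ∃ (t : ℝ) (e : EuclideanSpace ℝ (Fin p)), X₁ = t • x + e ∧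
      ⟪e, x⟫ = 0 := by
    refine ⟨⟪X₁, x⟫ / ⟪x, x⟫, X₁ - (⟪X₁, x⟫ / ⟪x, x⟫) • x, by simp, ?_⟩
    rw [inner_sub_left, real_inner_smul_left]
    field_simp
    ring
  have he : e ≠ 0 := fun h => hH ⟨t, by simp [h]⟩
  obtain ⟨f, hf, hxf, hef⟩ := exists_ne_zero_orthogonal_pair hp x e
  have hfx : ⟪f, x⟫ = 0 := by rw [real_inner_comm, hxf]
  have hfe : ⟪f, e⟫ = 0 := by rw [real_inner_comm, hef]
  have hxe : ⟪x, e⟫ = 0 := by rw [real_inner_comm, hex]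
  set l : ℝ := (α + 1) ^ 2 * ‖x‖ ^ (2 * α) with hl
  have hl0 : 0 < l := by positivity
  have hm : 0 < l * ⟪x, x⟫ := mul_pos hl0 hx
  obtain ⟨s, v, hsv, hsv0⟩ := exists_ne_zero_orthogonal_prod hq hm t w
  have hh : 0 < l * ⟪x, x⟫ * t ^ 2 + ⟪w, w⟫ := by
    by_cases hw : w = 0
    · have ht : t ≠ 0 := by
        rintro rfl
        exact hS ⟨hw, by simpa using hex⟩
      have := real_inner_self_nonneg (x := w)
      positivity
    · have := real_inner_self_pos.2 hw
      positivity
  have hee : 0 < ⟪e, e⟫ := real_inner_self_pos.2 he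
  have hff : 0 < ⟪f, f⟫ := real_inner_self_pos.2 hf
  set h := l * ⟪x, x⟫ * t ^ 2 + ⟪w, w⟫ with hhdef
  set k := l * ⟪x, x⟫ * s ^ 2 + ⟪v, v⟫ with hkdef
  have hvw : ⟪v, w⟫ = ⟪w, v⟫ := real_inner_comm _ _
  have hwv : ⟪w, v⟫ = -(l * ⟪x, x⟫ * (t * s)) := by linarith
  refine ⟨(s • x + f, v), (h • e - (l * ⟪e, e⟫) • t • x, -(l * ⟪e, e⟫) • w),
    (k • f - (l * ⟪f, f⟫) • s • x, -(l * ⟪f, f⟫) • v), ?_, ?_, ?_, ?_, ?_, ?_, ?_⟩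
  iterate 6
    · simp only [gMet, ← hl, inner_add_left, inner_sub_left, inner_add_right, inner_sub_right,
        real_inner_smul_left, real_inner_smul_right, hxf, hfx, hef, hfe, hex, hxe, hvw, hwv, h, k]
      ring
  rw [riem_eq α p q _ hz]
  have hc : -(α * (α + 2)) / ⟪x, x⟫ ≠ 0 :=
    div_ne_zero (neg_ne_zero.2 (by positivity)) hx.ne'
  refine mul_ne_zero (mul_ne_zero hl0.ne' hc) ?_
  have key : vInner x (t • x + e) (h • e - (l * ⟪e, e⟫) • t • x) *
        vInner x (s • x + f) (k • f - (l * ⟪f, f⟫) • s • x) -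
      vInner x (t • x + e) (k • f - (l * ⟪f, f⟫) • s • x) *
        vInner x (s • x + f) (h • e - (l * ⟪e, e⟫) • t • x) =
      h * ⟪e, e⟫ * (k * ⟪f, f⟫) := by
    simp only [vInner, inner_add_left, inner_sub_left, inner_sub_right, real_inner_smul_left,
      real_inner_smul_right, hxf, hfx, hef, hfe, hex, hxe]
    field_simp
    ring
  rw [key]
  positivity

theorem riem_eq_zero_of_vertical (α : ℝ) (hα : 0 < α) (p q : ℕ) (z : GVec p q) (hz : z.1 ≠ 0)
    {X Y U V : GVec p q} (hX : X ∈ TSp p q z) (hXU : gMet α p q z.1 X U = 0)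
    (hXV : gMet α p q z.1 X V = 0) : riem α p q z X Y U V = 0 := by
  obtain ⟨hX₂, hX₁⟩ := hX
  have hn : 0 < ‖z.1‖ := norm_pos_iff.2 hz
  have hl : (α + 1) ^ 2 * ‖z.1‖ ^ (2 * α) ≠ 0 := by positivity
  have hv {V : GVec p q} (h : gMet α p q z.1 X V = 0) : vInner z.1 X.1 V.1 = 0 := by
    rw [gMet, hX₂, inner_zero_left, add_zero] at h
    rw [vInner, hX₁, (mul_eq_zero.1 h).resolve_left hl]
    simp
  rw [riem_eq α p q z hz, hv hXU, hv hXV]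
  ring

theorem riem_eq_zero_of_horizontal (α : ℝ) (p q : ℕ) (z : GVec p q) (hz : z.1 ≠ 0)
    {X : GVec p q} (hX : X ∈ THp p q z) (Y U V : GVec p q) : riem α p q z X Y U V = 0 := by
  obtain ⟨t, ht⟩ := hX
  have hne : ⟪z.1, z.1⟫ ≠ 0 := inner_self_ne_zero.2 hz
  have hv (u : EuclideanSpace ℝ (Fin p)) : vInner z.1 X.1 u = 0 := by
    rw [vInner, ht, real_inner_smul_left, real_inner_smul_left, real_inner_comm u]
    field_simp
    ring
  rw [riem_eq α p q z hz, hv, hv]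
  ring

/-- identification of the conformally invariant cones `𝒰_P = T_P S ∪ T_P H`. -/
theorem grushin_weyl_cones
    (α : ℝ) (hα : 0 < α) (p q : ℕ) (hp : 3 ≤ p) (hq : 1 ≤ q)
    (z : GVec p q) (hz : z ∈ GM0 p q) :
    {X : GVec p q | ∀ Y U V : GVec p q,
        gMet α p q z.1 X Y = 0 → gMet α p q z.1 X U = 0 → gMet α p q z.1 X V = 0 →
        gMet α p q z.1 Y U = 0 → gMet α p q z.1 Y V = 0 → gMet α p q z.1 U V = 0 →
        weyl α p q z X Y U V = 0}
      = TSp p q z ∪ THp p q z := by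
  ext X
  constructor
  · intro hX
    by_contra hnot
    rw [Set.mem_union, not_or] at hnot
    obtain ⟨Y, U, V, hXY, hXU, hXV, hYU, hYV, hUV, hR⟩ :=
      exists_orthogonal_riem_ne_zero α hα p q hp hq z hz X hnot.1 hnot.2
    refine hR ?_
    rw [← weyl_eq_riem_of_orthogonal α p q z X Y U V hXU hXV hYU hYV]
    exact hX Y U V hXY hXU hXV hYU hYV hUV
  · rintro hX Y U V - hXU hXV hYU hYV -
    rw [weyl_eq_riem_of_orthogonal α p q z X Y U V hXU hXV hYU hYV]
    rcases hX with hX | hX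
    · exact riem_eq_zero_of_vertical α hα p q z hz hX hXU hXV
    · exact riem_eq_zero_of_horizontal α p q z hz hX Y U V

end
end

section
/- Let p ≥ 3 and q ≥ 1. Let Ω ⊂ M₀ be a connected open set and f : Ω → f(Ω) ⊂ M₀ a conformal diffeomorphism with respect to g. Then exactly one of the following holds: either Df(z)(T_z S) = T_{f(z)} S and Df(z)(T_z H) = T_{f(z)} H for every z ∈ Ω, or Df(z)(T_z S) = T_{f(z)} H and Df(z)(T_z H) = T_{f(z)} S for every z ∈ Ω (the latter being possible only if p − 1 = q + 1). -/
noncomputable section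

open scoped RealInnerProductSpace

section LinearAlgebra

variable {V : Type*} [AddCommGroup V] [Module ℝ V]

/-- A symmetric endomorphism with respect to a positive definite symmetric bilinear form on a
finite-dimensional space is diagonalisable. -/
theorem iSup_eigenspace_eq_top_of_posDef [FiniteDimensional ℝ V] (B : LinearMap.BilinForm ℝ V)
    (hs : ∀ x y, B x y = B y x) (hpos : ∀ x, x ≠ 0 → 0 < B x x) (Q : V →ₗ[ℝ] V)
    (hQ : ∀ x y, B (Q x) y = B x (Q y)) :
    ⨆ μ, Module.End.eigenspace Q μ = ⊤ := by
  let core : InnerProductSpace.Core ℝ V :=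
    { inner := fun x y => B x y
      conj_inner_symm := fun x y => by simpa using hs y x
      re_inner_nonneg := fun x => by
        rcases eq_or_ne x 0 with rfl | hx
        · simp
        · simpa using (hpos x hx).le
      add_left := fun x y z => by simp
      smul_left := fun x y r => by simp
      definite := fun x hx => by
        by_contra h
        exact (hpos x h).ne' hx }
  let _ : NormedAddCommGroup V := core.toNormedAddCommGroup
  let _ : InnerProductSpace ℝ V := InnerProductSpace.ofCore core.toCore
  have hsym : LinearMap.IsSymmetric Q := fun x y => hQ x y
  have h := hsym.orthogonalComplement_iSup_eigenspaces_eq_bot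
  exact (Submodule.orthogonal_eq_bot_iff).1 h

/-- The image of the projection `P` contains two nonzero `B`-orthogonal vectors. -/
def HasOrthPair (B : LinearMap.BilinForm ℝ V) (P : V →ₗ[ℝ] V) : Prop :=
  ∃ a b, P a = a ∧ P b = b ∧ a ≠ 0 ∧ b ≠ 0 ∧ B a b = 0

theorem HasOrthPair.exists_orth {B : LinearMap.BilinForm ℝ V} (hpos : ∀ x, x ≠ 0 → 0 < B x x)
    {P : V →ₗ[ℝ] V} (h : HasOrthPair B P) (e : V) : ∃ s, P s = s ∧ s ≠ 0 ∧ B s e = 0 := by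
  obtain ⟨a, b, ha, hb, ha0, hb0, hab⟩ := h
  by_cases hae : B a e = 0
  · exact ⟨a, ha, ha0, hae⟩
  · refine ⟨(B b e) • a - (B a e) • b, by simp [ha, hb], fun h0 => ?_, by simp; ring⟩
    have h1 : B ((B b e) • a - (B a e) • b) b = 0 := by rw [h0]; simp
    simp [hab, hae, (hpos b hb0).ne'] at h1

/-- The image of a projection is not contained in a line if it contains an orthogonal pair. -/
theorem HasOrthPair.not_forall_mem_line {B : LinearMap.BilinForm ℝ V}
    (hpos : ∀ x, x ≠ 0 → 0 < B x x) {P : V →ₗ[ℝ] V} (h : HasOrthPair B P) (v : V) :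
    ¬ ∀ x, ∃ t : ℝ, P x = t • v := by
  intro hl
  obtain ⟨s, hs, hs0, hsv⟩ := h.exists_orth hpos v
  obtain ⟨t, ht⟩ := hl s
  have h1 : B s s = 0 := by
    nth_rewrite 2 [← hs]
    rw [ht]; simp [hsv]
  exact (hpos s hs0).ne' h1

/-- A symmetric projection on an image with orthogonal pairs, commuting with another one, has an
eigenvector in that image orthogonal to a given eigenvector. -/
theorem HasOrthPair.exists_orth_eigenvector {B : LinearMap.BilinForm ℝ V}
    (hpos : ∀ x, x ≠ 0 → 0 < B x x) {P P' : V →ₗ[ℝ] V} (h : HasOrthPair B P)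
    (hP' : ∀ x, P' (P' x) = P' x) (hs' : ∀ x y, B (P' x) y = B x (P' y))
    (hcomm : ∀ x, P (P' x) = P' (P x)) (e : V) (ε : ℝ) (he : P' e = ε • e) :
    ∃ s, P s = s ∧ B s s = 1 ∧ B s e = 0 ∧ ∃ η : ℝ, P' s = η • s := by
  have key : ∃ s, P s = s ∧ s ≠ 0 ∧ B s e = 0 ∧ ∃ η : ℝ, P' s = η • s := by
    obtain ⟨s, hs, hs0, hse⟩ := h.exists_orth hpos e
    by_cases h0 : P' s = 0
    · exact ⟨s, hs, hs0, hse, 0, by simp [h0]⟩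
    · exact ⟨P' s, by rw [hcomm, hs], h0, by rw [hs', he]; simp [hse], 1, by simp [hP']⟩
  obtain ⟨s, hs, hs0, hse, η, hη⟩ := key
  have hss := hpos s hs0
  refine ⟨(√(B s s))⁻¹ • s, by simp [hs], ?_, by simp [hse], η, by rw [map_smul, hη, smul_comm]⟩
  simp only [map_smul, LinearMap.smul_apply, smul_eq_mul]
  rw [← mul_assoc, ← mul_inv, Real.mul_self_sqrt hss.le, inv_mul_cancel₀ hss.ne']

/-- Two symmetric projections agree up to a factor in the Weyl part of their curvature-like
squares. -/
def WeylRelated (B : LinearMap.BilinForm ℝ V) (c : ℝ) (P P' : V →ₗ[ℝ] V) : Prop :=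
  ∀ X U W T, B X U = 0 → B X W = 0 → B X T = 0 → B U W = 0 → B U T = 0 → B W T = 0 →
    c * (B (P' U) W * B (P' X) T - B (P' X) W * B (P' U) T)
      = B (P U) W * B (P X) T - B (P X) W * B (P U) T

theorem WeylRelated.commute [FiniteDimensional ℝ V] {B : LinearMap.BilinForm ℝ V}
    (hs : ∀ x y, B x y = B y x) (hpos : ∀ x, x ≠ 0 → 0 < B x x) {P P' : V →ₗ[ℝ] V}
    (hP : ∀ x, P (P x) = P x) (hPs : ∀ x y, B (P x) y = B x (P y))
    (hP' : ∀ x, P' (P' x) = P' x) (hPs' : ∀ x y, B (P' x) y = B x (P' y))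
    {c : ℝ} (hc : c ≠ 0) (hW : WeylRelated B c P P')
    (hS' : HasOrthPair B P') (hH' : HasOrthPair B (LinearMap.id - P')) (x : V) :
    P (P' x) = P' (P x) := by
  have hdef : ∀ x, B x x = 0 → x = 0 := fun x hx => by
    by_contra h0
    exact (hpos x h0).ne' hx
  -- an eigenvector `e` of `P P' P` in the image of `P` is an eigenvector of `P'`
  have main : ∀ (e : V) (μ : ℝ), P e = e → P (P' e) = μ • e → P' e = μ • e := by
    intro e μ he hμ
    set h := P' e - μ • e with hh
    have hPe : P' e = μ • e + h := by rw [hh]; abel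
    by_contra hne
    have h0 : h ≠ 0 := fun h0 => hne (by rw [hPe, h0, add_zero])
    have hPh : P h = 0 := by rw [hh]; simp [he, hμ]
    have heh : B e h = 0 := by
      rw [← he, hPs, hPh]; simp
    have hP'h : P' h = (1 - μ) • (μ • e + h) := by
      rw [hh, map_sub, map_smul, hP', hPe, ← hPe]; module
    have hhh : B (P' e) h = B h h := by rw [hPe]; simp [heh]
    have hhh0 := (hpos h h0).ne'
    -- `P'` preserves orthogonality in the complement of the plane
    have horth : ∀ U W, B e U = 0 → B e W = 0 → B h U = 0 → B h W = 0 → B U W = 0 →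
        B (P' U) W = 0 := by
      intro U W h1 h2 h3 h4 h5
      have := hW e U W h h1 h2 heh h5 (by rw [hs]; exact h3) (by rw [hs]; exact h4)
      have e1 : B (P' e) W = 0 := by rw [hPe]; simp [h2, h4]
      have e2 : B (P e) h = 0 := by rw [he]; exact heh
      have e3 : B (P U) h = 0 := by rw [hPs, hPh]; simp
      rw [e1, e2, e3, hhh] at this
      simpa [hc, hhh0] using this
    have hinv : ∀ U, B e U = 0 → B h U = 0 → B e (P' U) = 0 ∧ B h (P' U) = 0 := by
      intro U h1 h2
      constructor
      · rw [← hPs', hPe]; simp [h1, h2]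
      · rw [← hPs', hP'h]; simp [h1, h2]
    -- hence `P'` is `0` or `1` there
    have hdich : ∀ U, B e U = 0 → B h U = 0 → P' U = 0 ∨ P' U = U := by
      intro U h1 h2
      by_contra! hcon
      have hi := hinv U h1 h2
      have hz : B (P' U) (U - P' U) = 0 := by
        rw [map_sub, hPs' U U, hPs' U (P' U), hP', sub_self]
      have hna := hpos _ hcon.1
      have hnb := hpos _ (sub_ne_zero.2 hcon.2.symm)
      have key := horth (B (U - P' U) (U - P' U) • P' U + B (P' U) (P' U) • (U - P' U))
        (P' U - (U - P' U)) (by simp [h1, hi.1]) (by simp [h1, hi.1]) (by simp [h2, hi.2])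
        (by simp [h2, hi.2]) (by
          have hz' : B (U - P' U) (P' U) = 0 := by rw [hs, hz]
          set a := P' U
          set b := U - P' U
          simp only [map_add, map_sub, map_smul, LinearMap.add_apply, LinearMap.smul_apply,
            smul_eq_mul, hz, hz']
          ring)
      have hk : P' (B (U - P' U) (U - P' U) • P' U + B (P' U) (P' U) • (U - P' U))
          = B (U - P' U) (U - P' U) • P' U := by
        rw [map_add, map_smul, map_smul, map_sub P', hP', sub_self, smul_zero, add_zero]
      rw [hk, map_sub, map_smul, LinearMap.smul_apply, LinearMap.smul_apply, hz, smul_zero,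
        sub_zero, smul_eq_mul] at key
      exact (mul_pos hnb hna).ne' key
    -- decomposition of a vector along the plane and its complement
    have he0 : e ≠ 0 := by
      rintro rfl
      apply h0; rw [hh]; simp
    have hee := (hpos e he0).ne'
    have hdec : ∀ x, ∃ (s t : ℝ) (U : V), x = s • e + t • h + U ∧ B e U = 0 ∧ B h U = 0 := by
      intro x
      refine ⟨B e x / B e e, B h x / B h h, x - (B e x / B e e) • e - (B h x / B h h) • h,
        by abel, ?_, ?_⟩
      · simp [heh, hee]
      · simp [hs h e, heh, hhh0]
    have hall : (∀ U, B e U = 0 → B h U = 0 → P' U = 0) ∨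
        (∀ U, B e U = 0 → B h U = 0 → P' U = U) := by
      by_contra! hcon
      obtain ⟨⟨U, h1, h2, h3⟩, W, h4, h5, h6⟩ := hcon
      have hU := (hdich U h1 h2).resolve_left h3
      have hWW := (hdich W h4 h5).resolve_right h6
      rcases hdich (U + W) (by simp [h1, h4]) (by simp [h2, h5]) with h7 | h7
      · rw [map_add, hWW, add_zero] at h7
        exact h3 h7
      · rw [map_add, hWW, hU, add_zero] at h7
        have : W = 0 := by simpa using h7
        exact h6 (by rw [this, map_zero])
    rcases hall with h1 | h1
    · refine hS'.not_forall_mem_line hpos (μ • e + h) fun x => ?_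
      obtain ⟨s, t, U, hx, hU1, hU2⟩ := hdec x
      refine ⟨s + t * (1 - μ), ?_⟩
      rw [hx, map_add, map_add, map_smul, map_smul, h1 U hU1 hU2, hPe, hP'h]
      module
    · refine hH'.not_forall_mem_line hpos (e - P' e) fun x => ?_
      obtain ⟨s, t, U, hx, hU1, hU2⟩ := hdec x
      refine ⟨s - t * μ, ?_⟩
      rw [LinearMap.sub_apply, LinearMap.id_apply, hx, map_add, map_add, map_smul, map_smul,
        h1 U hU1 hU2, hP'h, hPe]
      module
  have htop := iSup_eigenspace_eq_top_of_posDef B hs hpos (P ∘ₗ P' ∘ₗ P) (fun x y => by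
    simp only [LinearMap.comp_apply]; rw [hPs, hPs', hPs])
  have hle : (⨆ μ, Module.End.eigenspace (P ∘ₗ P' ∘ₗ P) μ) ≤
      LinearMap.ker (P ∘ₗ P' ∘ₗ P - P' ∘ₗ P) := by
    refine iSup_le fun μ v hv => ?_
    rw [Module.End.mem_eigenspace_iff] at hv
    simp only [LinearMap.comp_apply] at hv
    have h1 : P (P' (P v)) = μ • P v := by
      rw [← hP, hv, map_smul]
    have h2 := main (P v) μ (hP v) h1
    simp [LinearMap.mem_ker, h2, hP]
  have hA : ∀ y, P (P' (P y)) = P' (P y) := by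
    intro y
    have : y ∈ LinearMap.ker (P ∘ₗ P' ∘ₗ P - P' ∘ₗ P) := hle (htop ▸ Submodule.mem_top)
    simpa [LinearMap.mem_ker, sub_eq_zero] using this
  have hB : P (P' x) = P (P' (P x)) := by
    rw [← sub_eq_zero]
    apply hdef
    set w := P (P' x) - P (P' (P x)) with hw
    nth_rewrite 1 [hw]
    rw [map_sub B, LinearMap.sub_apply, hPs, hPs', hPs, hPs', hPs, hA, sub_self]
  rw [hB, hA]

theorem WeylRelated.eigenvalue_ne {B : LinearMap.BilinForm ℝ V}
    (hs : ∀ x y, B x y = B y x) (hpos : ∀ x, x ≠ 0 → 0 < B x x) {P P' : V →ₗ[ℝ] V}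
    (hPs : ∀ x y, B (P x) y = B x (P y))
    (hP' : ∀ x, P' (P' x) = P' x) (hPs' : ∀ x y, B (P' x) y = B x (P' y))
    {c : ℝ} (hW : WeylRelated B c P P')
    (hS : HasOrthPair B P) (hH : HasOrthPair B (LinearMap.id - P))
    (hcomm : ∀ x, P (P' x) = P' (P x)) {e h : V} {ε η : ℝ} (he : P e = e) (hh : P h = 0)
    (he1 : B e e = 1) (hh1 : B h h = 1) (hε : P' e = ε • e) (hη : P' h = η • h) : ε ≠ η := by
  rintro rfl
  have hcross : ∀ a b, P a = a → P b = 0 → B a b = 0 ∧ B b a = 0 := by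
    intro a b ha hb
    have : B a b = 0 := by rw [← ha, hPs, hb]; simp
    exact ⟨this, by rw [hs, this]⟩
  obtain ⟨e₂, he₂, he₂1, hee, ε₂, hε₂⟩ :=
    hS.exists_orth_eigenvector hpos hP' hPs' hcomm e ε hε
  obtain ⟨h₂, hh₂, hh₂1, hhh, η₂, hη₂⟩ :=
    hH.exists_orth_eigenvector hpos hP' hPs' (fun x => by simp [hcomm]) h ε hη
  replace hh₂ : P h₂ = 0 := by simpa using hh₂
  have hee' : B e e₂ = 0 := by rw [hs, hee]
  have hhh' : B h h₂ = 0 := by rw [hs, hhh]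
  obtain ⟨c1, c1'⟩ := hcross e h he hh
  obtain ⟨c2, c2'⟩ := hcross e h₂ he hh₂
  obtain ⟨c3, c3'⟩ := hcross e₂ h he₂ hh
  obtain ⟨c4, c4'⟩ := hcross e₂ h₂ he₂ hh₂
  have := hW (e + h) (e₂ + h₂) (e₂ - h₂) (e - h)
  simp [*] at this

/-- Weyl-related symmetric projections are equal or complementary. -/
theorem WeylRelated.eq_or_eq_compl [FiniteDimensional ℝ V] {B : LinearMap.BilinForm ℝ V}
    (hs : ∀ x y, B x y = B y x) (hpos : ∀ x, x ≠ 0 → 0 < B x x) {P P' : V →ₗ[ℝ] V}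
    (hP : ∀ x, P (P x) = P x) (hPs : ∀ x y, B (P x) y = B x (P y))
    (hP' : ∀ x, P' (P' x) = P' x) (hPs' : ∀ x y, B (P' x) y = B x (P' y))
    {c : ℝ} (hc : c ≠ 0) (hW : WeylRelated B c P P')
    (hS : HasOrthPair B P) (hH : HasOrthPair B (LinearMap.id - P))
    (hS' : HasOrthPair B P') (hH' : HasOrthPair B (LinearMap.id - P')) :
    (∀ x, P' x = P x) ∨ (∀ x, P' x = x - P x) := by
  have hcomm := hW.commute hs hpos hP hPs hP' hPs' hc hS' hH'
  have hnorm : ∀ v, v ≠ 0 → ∃ r : ℝ, r ≠ 0 ∧ B (r • v) (r • v) = 1 := by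
    intro v hv
    have hvv := hpos v hv
    refine ⟨(√(B v v))⁻¹, inv_ne_zero (Real.sqrt_pos.2 hvv).ne', ?_⟩
    simp only [map_smul, LinearMap.smul_apply, smul_eq_mul]
    rw [← mul_assoc, ← mul_inv, Real.mul_self_sqrt hvv.le, inv_mul_cancel₀ hvv.ne']
  have hne : ∀ {e h : V} {ε η : ℝ}, P e = e → P h = 0 → e ≠ 0 → h ≠ 0 → P' e = ε • e →
      P' h = η • h → ε ≠ η := by
    intro e h ε η he hh he0 hh0 hε hη
    obtain ⟨r, -, hr⟩ := hnorm e he0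
    obtain ⟨s, -, hs'⟩ := hnorm h hh0
    exact hW.eigenvalue_ne hs hpos hPs hP' hPs' hS hH hcomm (e := r • e) (h := s • h)
      (by simp [he]) (by simp [hh]) hr hs' (by rw [map_smul, hε, smul_comm])
      (by rw [map_smul, hη, smul_comm])
  obtain ⟨a, -, ha, -, ha0, -, -⟩ := hS
  obtain ⟨b, -, hb, -, hb0, -, -⟩ := hH
  replace hb : P b = 0 := by simpa using hb
  have hPP : ∀ x, P (x - P x) = 0 := fun x => by rw [map_sub, hP, sub_self]
  have hsplit : ∀ x, P' x = P' (P x) + P' (x - P x) := fun x => by rw [← map_add]; simp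
  have hker : ∀ x, P' (x - P' x) = (0 : ℝ) • (x - P' x) := fun x => by
    rw [map_sub, hP', sub_self, zero_smul]
  have himg : ∀ x, P' (P' x) = (1 : ℝ) • P' x := fun x => by rw [hP', one_smul]
  have hPker : ∀ {x}, P x = x → P (x - P' x) = x - P' x := fun {x} hx => by
    rw [map_sub, hcomm, hx]
  have hPker' : ∀ {x}, P x = 0 → P (x - P' x) = 0 := fun {x} hx => by
    rw [map_sub, hcomm, hx]; simp
  have hPimg : ∀ {x}, P x = x → P (P' x) = P' x := fun {x} hx => by rw [hcomm, hx]
  have hPimg' : ∀ {x}, P x = 0 → P (P' x) = 0 := fun {x} hx => by rw [hcomm, hx, map_zero]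
  by_cases hcase : P' a = 0
  · right
    have h1 : ∀ y, P y = 0 → P' y = y := by
      intro y hy
      by_contra h0
      exact hne ha (hPker' hy) ha0 (sub_ne_zero.2 (Ne.symm h0)) (by rw [hcase, zero_smul])
        (hker y) rfl
    have h2 : ∀ x, P x = x → P' x = 0 := by
      intro x hx
      by_contra h0
      exact hne (hPimg hx) hb h0 hb0 (himg x) (by rw [h1 b hb, one_smul]) rfl
    intro x
    rw [hsplit, h2 _ (hP x), h1 _ (hPP x), zero_add]
  · left
    have h1 : ∀ y, P y = 0 → P' y = 0 := by
      intro y hy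
      by_contra h0
      exact hne (hPimg ha) (hPimg' hy) hcase h0 (himg a) (himg y) rfl
    have h2 : ∀ x, P x = x → P' x = x := by
      intro x hx
      by_contra h0
      exact hne (hPker hx) hb (sub_ne_zero.2 (Ne.symm h0)) hb0 (hker x)
        (by rw [h1 b hb, zero_smul]) rfl
    intro x
    rw [hsplit, h2 _ (hP x), h1 _ (hPP x), add_zero]

end LinearAlgebra
section Geometry

variable {α : ℝ} {p q : ℕ}

theorem norm_rpow_neg_two {F : Type*} [NormedAddCommGroup F] (x : F) :
    ‖x‖ ^ (-(2 : ℝ)) = (‖x‖ ^ 2)⁻¹ := by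
  rw [Real.rpow_neg (norm_nonneg x), Real.rpow_two]

theorem norm_rpow_two_mul {F : Type*} [NormedAddCommGroup F] (x : F) (a : ℝ) :
    ‖x‖ ^ (2 * a) = (‖x‖ ^ 2) ^ a := by
  rw [Real.rpow_mul (norm_nonneg x), Real.rpow_two]

theorem gMet_comm (x : EuclideanSpace ℝ (Fin p)) (U V : GVec p q) :
    gMet α p q x U V = gMet α p q x V U := by
  simp only [gMet, real_inner_comm]

theorem gMet_add_left (x : EuclideanSpace ℝ (Fin p)) (U V W : GVec p q) :
    gMet α p q x (U + V) W = gMet α p q x U W + gMet α p q x V W := by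
  simp only [gMet, Prod.fst_add, Prod.snd_add, inner_add_left]; ring

theorem gMet_add_right (x : EuclideanSpace ℝ (Fin p)) (U V W : GVec p q) :
    gMet α p q x W (U + V) = gMet α p q x W U + gMet α p q x W V := by
  rw [gMet_comm, gMet_add_left, gMet_comm x U, gMet_comm x V]

theorem gMet_smul_left (x : EuclideanSpace ℝ (Fin p)) (r : ℝ) (U W : GVec p q) :
    gMet α p q x (r • U) W = r * gMet α p q x U W := by
  simp only [gMet, Prod.smul_fst, Prod.smul_snd, real_inner_smul_left]; ring

theorem gMet_smul_right (x : EuclideanSpace ℝ (Fin p)) (r : ℝ) (U W : GVec p q) :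
    gMet α p q x W (r • U) = r * gMet α p q x W U := by
  rw [gMet_comm, gMet_smul_left, gMet_comm]

theorem gMet_sub_left (x : EuclideanSpace ℝ (Fin p)) (U V W : GVec p q) :
    gMet α p q x (U - V) W = gMet α p q x U W - gMet α p q x V W := by
  simp only [gMet, Prod.fst_sub, Prod.snd_sub, inner_sub_left]; ring

/-- The weight of the metric on the `x`-directions. -/
def gWeight (α : ℝ) {p : ℕ} (x : EuclideanSpace ℝ (Fin p)) : ℝ := (α + 1) ^ 2 * ‖x‖ ^ (2 * α)

theorem gWeight_pos (hα : 0 < α) {x : EuclideanSpace ℝ (Fin p)} (hx : x ≠ 0) :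
    0 < gWeight α x := by
  have := norm_pos_iff.2 hx
  unfold gWeight
  positivity

theorem gMet_self_pos (hα : 0 < α) {x : EuclideanSpace ℝ (Fin p)} (hx : x ≠ 0) {U : GVec p q}
    (hU : U ≠ 0) : 0 < gMet α p q x U U := by
  have hw := gWeight_pos hα hx
  unfold gWeight at hw
  simp only [gMet, real_inner_self_eq_norm_sq]
  by_cases h1 : U.1 = 0
  · have h2 : U.2 ≠ 0 := fun h2 => hU (Prod.ext h1 h2)
    have := norm_pos_iff.2 h2
    positivity
  · have := norm_pos_iff.2 h1
    positivity

/-- The metric at a point as a bilinear form. -/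
def gForm (α : ℝ) {p q : ℕ} (x : EuclideanSpace ℝ (Fin p)) : LinearMap.BilinForm ℝ (GVec p q) :=
  LinearMap.mk₂ ℝ (gMet α p q x) (gMet_add_left x)
    (fun r U W => gMet_smul_left x r U W)
    (fun W U V => gMet_add_right x U V W) (fun r W U => gMet_smul_right x r U W)

/-- Derivative of the Christoffel contraction in the base point, in the direction `X`. -/
def gammaDer (α : ℝ) (p q : ℕ) (x : EuclideanSpace ℝ (Fin p)) (X U V : GVec p q) : GVec p q :=
  ((-(2 * α * ⟪x, X.1⟫) * ((‖x‖ ^ 2) ^ 2)⁻¹) •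
      (⟪x, V.1⟫ • U.1 + ⟪x, U.1⟫ • V.1 - ⟪U.1, V.1⟫ • x)
    + (α * (‖x‖ ^ 2)⁻¹) • (⟪X.1, V.1⟫ • U.1 + ⟪X.1, U.1⟫ • V.1 - ⟪U.1, V.1⟫ • X.1), 0)

theorem gammaMap_comm (x : EuclideanSpace ℝ (Fin p)) (U V : GVec p q) :
    gammaMap α p q x U V = gammaMap α p q x V U := by
  simp only [gammaMap, real_inner_comm, Prod.mk.injEq, and_true]
  module

theorem gammaMap_add_right (x : EuclideanSpace ℝ (Fin p)) (U V W : GVec p q) :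
    gammaMap α p q x W (U + V) = gammaMap α p q x W U + gammaMap α p q x W V := by
  simp only [gammaMap, Prod.fst_add, inner_add_right, Prod.mk_add_mk, add_zero, Prod.mk.injEq,
    and_true]
  module

theorem HasDerivAt.fst' {E F : Type*} [NormedAddCommGroup E] [NormedSpace ℝ E]
    [NormedAddCommGroup F] [NormedSpace ℝ F] {γ : ℝ → E × F} {γ' : E × F} {t : ℝ}
    (h : HasDerivAt γ γ' t) : HasDerivAt (fun s => (γ s).1) γ'.1 t :=
  (ContinuousLinearMap.fst ℝ E F).hasFDerivAt.comp_hasDerivAt t h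

theorem HasDerivAt.snd' {E F : Type*} [NormedAddCommGroup E] [NormedSpace ℝ E]
    [NormedAddCommGroup F] [NormedSpace ℝ F] {γ : ℝ → E × F} {γ' : E × F} {t : ℝ}
    (h : HasDerivAt γ γ' t) : HasDerivAt (fun s => (γ s).2) γ'.2 t :=
  (ContinuousLinearMap.snd ℝ E F).hasFDerivAt.comp_hasDerivAt t h

theorem HasDerivAt.gammaMap {γ U V : ℝ → GVec p q} {γ' U' V' : GVec p q} {t : ℝ}
    (hγ : HasDerivAt γ γ' t) (hU : HasDerivAt U U' t) (hV : HasDerivAt V V' t)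
    (h0 : (γ t).1 ≠ 0) :
    HasDerivAt (fun s => gammaMap α p q (γ s).1 (U s) (V s))
      (gammaDer α p q (γ t).1 γ' (U t) (V t) + _root_.gammaMap α p q (γ t).1 U' (V t)
        + _root_.gammaMap α p q (γ t).1 (U t) V') t := by
  have hx := hγ.fst'
  have hu := hU.fst'
  have hv := hV.fst'
  have hn := hx.norm_sq
  have hn0 : ‖(γ t).1‖ ^ 2 ≠ 0 := by simpa using h0
  have h1 := ((hn.fun_inv hn0).const_mul α).fun_smul
    ((((hx.inner ℝ hv).fun_smul hu).fun_add ((hx.inner ℝ hu).fun_smul hv)).fun_sub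
      ((hu.inner ℝ hv).fun_smul hx))
  have h2 := h1.prodMk (hasDerivAt_const t (0 : EuclideanSpace ℝ (Fin q)))
  simp only [_root_.gammaMap, gammaDer, norm_rpow_neg_two]
  refine h2.congr_deriv ?_
  simp only [Prod.mk_add_mk, add_zero, Prod.mk.injEq, and_true]
  module

theorem HasDerivAt.gMet {γ U V : ℝ → GVec p q} {γ' U' V' : GVec p q} {t : ℝ}
    (hγ : HasDerivAt γ γ' t) (hU : HasDerivAt U U' t) (hV : HasDerivAt V V' t)
    (h0 : (γ t).1 ≠ 0) :
    HasDerivAt (fun s => gMet α p q (γ s).1 (U s) (V s))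
      (_root_.gMet α p q (γ t).1 (U' + _root_.gammaMap α p q (γ t).1 γ' (U t)) (V t)
        + _root_.gMet α p q (γ t).1 (U t) (V' + _root_.gammaMap α p q (γ t).1 γ' (V t))) t := by
  have hn := hγ.fst'.norm_sq
  have hn0 : ‖(γ t).1‖ ^ 2 ≠ 0 := by simpa using h0
  have h1 := (((hn.rpow_const (p := α) (Or.inl hn0)).const_mul ((α + 1) ^ 2)).fun_mul
    (hU.fst'.inner ℝ hV.fst')).fun_add (hU.snd'.inner ℝ hV.snd')
  simp only [_root_.gMet, norm_rpow_two_mul]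
  refine h1.congr_deriv ?_
  rw [Real.rpow_sub_one hn0]
  simp only [_root_.gammaMap, norm_rpow_neg_two, Prod.fst_add, Prod.snd_add, inner_add_left,
    inner_add_right, inner_sub_left, inner_sub_right, real_inner_smul_left,
    real_inner_smul_right, inner_zero_left, inner_zero_right]
  rw [real_inner_comm (V t).1 γ'.1, real_inner_comm (γ t).1 (U t).1,
    real_inner_comm (U t).1 γ'.1]
  field_simp
  ring

/-- The curvature operator of the metric. -/
def gCurv (α : ℝ) (p q : ℕ) (x : EuclideanSpace ℝ (Fin p)) (X U V : GVec p q) : GVec p q :=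
  gammaDer α p q x X U V - gammaDer α p q x U X V
    + gammaMap α p q x X (gammaMap α p q x U V) - gammaMap α p q x U (gammaMap α p q x X V)

/-- The curvature is carried by the vertical distribution. -/
theorem gMet_gCurv (hα : 0 < α) {z : GVec p q} (hz : z.1 ≠ 0) (X U V T : GVec p q) :
    gMet α p q z.1 (gCurv α p q z.1 X U V) T
      = -(α * (α + 2)) / (gWeight α z.1 * ‖z.1‖ ^ 2) *
        (gMet α p q z.1 (projS p q z U) V * gMet α p q z.1 (projS p q z X) T
          - gMet α p q z.1 (projS p q z X) V * gMet α p q z.1 (projS p q z U) T) := by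
  have hw := (gWeight_pos hα hz).ne'
  have hn0 : ‖z.1‖ ^ 2 ≠ 0 := by simpa using hz
  unfold gWeight at *
  simp only [gMet, gCurv, gammaDer, gammaMap, projS, norm_rpow_neg_two, Prod.fst_add,
    Prod.fst_sub, Prod.snd_sub,
    Prod.snd_add, inner_add_left, inner_sub_left, inner_add_right, inner_sub_right,
    real_inner_smul_left, real_inner_smul_right, inner_zero_left]
  set m := (α + 1) ^ 2 * ‖z.1‖ ^ (2 * α)
  set n := ‖z.1‖ ^ 2 with hn
  rw [real_inner_self_eq_norm_sq, ← hn, real_inner_comm z.1 X.1, real_inner_comm z.1 U.1,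
    real_inner_comm X.1 U.1]
  field_simp
  ring

end Geometry

section Conformal

variable {α : ℝ} {p q : ℕ}

/-- `f` is a smooth map on the open set `Ω` pulling the metric back to `ℓ` times the metric. -/
structure IsConformalOn (α : ℝ) (p q : ℕ) (f : GVec p q → GVec p q) (Ω : Set (GVec p q))
    (ℓ : GVec p q → ℝ) : Prop where
  isOpen : IsOpen Ω
  ne_zero : ∀ z ∈ Ω, z.1 ≠ 0
  map_ne_zero : ∀ z ∈ Ω, (f z).1 ≠ 0
  contDiffAt : ∀ z ∈ Ω, ContDiffAt ℝ (⊤ : ℕ∞) f z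
  contDiffAt_factor : ∀ z ∈ Ω, ContDiffAt ℝ (⊤ : ℕ∞) ℓ z
  pos : ∀ z ∈ Ω, 0 < ℓ z
  gMet_map : ∀ z ∈ Ω, ∀ U V, gMet α p q (f z).1 (fderiv ℝ f z U) (fderiv ℝ f z V)
    = ℓ z * gMet α p q z.1 U V

/-- The covariant second derivative `∇_{U} (Df V)` of `f` along itself. -/
def covHess (α : ℝ) (p q : ℕ) (f : GVec p q → GVec p q) (z U V : GVec p q) : GVec p q :=
  fderiv ℝ (fderiv ℝ f) z U V + gammaMap α p q (f z).1 (fderiv ℝ f z U) (fderiv ℝ f z V)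

theorem hasDerivAt_add_smul {E : Type*} [NormedAddCommGroup E] [NormedSpace ℝ E] (z X : E) :
    HasDerivAt (fun t : ℝ => z + t • X) X 0 := by
  simpa using ((hasDerivAt_id (0 : ℝ)).smul_const X).const_add z

theorem DifferentiableAt.hasDerivAt_add_smul {E F : Type*} [NormedAddCommGroup E]
    [NormedSpace ℝ E] [NormedAddCommGroup F] [NormedSpace ℝ F] {g : E → F} {z : E}
    (h : DifferentiableAt ℝ g z) (X : E) :
    HasDerivAt (fun t : ℝ => g (z + t • X)) (fderiv ℝ g z X) 0 := by
  have h' : HasFDerivAt g (fderiv ℝ g z) (z + (0 : ℝ) • X) := by simpa using h.hasFDerivAt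
  exact h'.comp_hasDerivAt 0 (_root_.hasDerivAt_add_smul z X)

theorem HasDerivAt.clm_apply_const {E F : Type*} [NormedAddCommGroup E]
    [NormedSpace ℝ E] [NormedAddCommGroup F] [NormedSpace ℝ F] {A : ℝ → E →L[ℝ] F}
    {A' : E →L[ℝ] F} {t : ℝ} (h : HasDerivAt A A' t) (U : E) :
    HasDerivAt (fun s => A s U) (A' U) t := by
  simpa using h.clm_apply (hasDerivAt_const t U)

theorem ContDiffAt.fderiv_top {E F : Type*} [NormedAddCommGroup E]
    [NormedSpace ℝ E] [NormedAddCommGroup F] [NormedSpace ℝ F] {g : E → F} {z : E}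
    (h : ContDiffAt ℝ (⊤ : ℕ∞) g z) : ContDiffAt ℝ (⊤ : ℕ∞) (fderiv ℝ g) z :=
  h.fderiv_right (by simp)

theorem ContDiffAt.fderiv_fderiv_comm {E F : Type*} [NormedAddCommGroup E]
    [NormedSpace ℝ E] [NormedAddCommGroup F] [NormedSpace ℝ F] {g : E → F} {z : E}
    (h : ContDiffAt ℝ (⊤ : ℕ∞) g z) (U V : E) :
    fderiv ℝ (fderiv ℝ g) z U V = fderiv ℝ (fderiv ℝ g) z V U :=
  (h.isSymmSndFDerivAt (by
    rw [minSmoothness_of_isRCLikeNormedField]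
    exact WithTop.coe_le_coe.2 (le_top : (2 : ℕ∞) ≤ ⊤))) U V

namespace IsConformalOn

variable {f : GVec p q → GVec p q} {Ω : Set (GVec p q)} {ℓ : GVec p q → ℝ}

theorem eventually_mem (hf : IsConformalOn α p q f Ω ℓ) {z : GVec p q} (hz : z ∈ Ω)
    (X : GVec p q) : ∀ᶠ t : ℝ in nhds 0, z + t • X ∈ Ω := by
  have h := (hasDerivAt_add_smul z X).continuousAt
  exact h.eventually_mem (hf.isOpen.mem_nhds (by simpa using hz))

theorem differentiableAt_fderiv (hf : IsConformalOn α p q f Ω ℓ) {z : GVec p q} (hz : z ∈ Ω) :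
    DifferentiableAt ℝ (fderiv ℝ f) z :=
  (hf.contDiffAt z hz).fderiv_top.differentiableAt (by simp)

theorem covHess_comm (hf : IsConformalOn α p q f Ω ℓ) {z : GVec p q} (hz : z ∈ Ω)
    (U V : GVec p q) : covHess α p q f z U V = covHess α p q f z V U := by
  rw [covHess, covHess, (hf.contDiffAt z hz).fderiv_fderiv_comm, gammaMap_comm]

theorem gMet_covHess_add (hf : IsConformalOn α p q f Ω ℓ) {z : GVec p q} (hz : z ∈ Ω)
    (U V T : GVec p q) :
    gMet α p q (f z).1 (covHess α p q f z U V) (fderiv ℝ f z T)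
      + gMet α p q (f z).1 (fderiv ℝ f z V) (covHess α p q f z U T)
      = fderiv ℝ ℓ z U * gMet α p q z.1 V T
        + ℓ z * (gMet α p q z.1 (gammaMap α p q z.1 U V) T
          + gMet α p q z.1 V (gammaMap α p q z.1 U T)) := by
  have hfd := ((hf.contDiffAt z hz).differentiableAt (by simp)).hasDerivAt_add_smul U
  have hA := (hf.differentiableAt_fderiv hz).hasDerivAt_add_smul U
  have hℓ := ((hf.contDiffAt_factor z hz).differentiableAt (by simp)).hasDerivAt_add_smul U
  have h1 := hfd.gMet (α := α) (hA.clm_apply_const V) (hA.clm_apply_const T)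
    (by simpa using hf.map_ne_zero z hz)
  have h2 := hℓ.fun_mul ((hasDerivAt_add_smul z U).gMet (α := α) (hasDerivAt_const 0 V)
    (hasDerivAt_const 0 T) (by simpa using hf.ne_zero z hz))
  have h3 := h1.unique (h2.congr_of_eventuallyEq (by
    filter_upwards [hf.eventually_mem hz U] with t ht using hf.gMet_map _ ht V T))
  simpa [covHess] using h3

/-- Koszul formula for a conformal map. -/
theorem gMet_covHess (hf : IsConformalOn α p q f Ω ℓ) {z : GVec p q} (hz : z ∈ Ω)
    (U V T : GVec p q) :
    gMet α p q (f z).1 (covHess α p q f z U V) (fderiv ℝ f z T)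
      = ℓ z * gMet α p q z.1 (gammaMap α p q z.1 U V) T
        + (fderiv ℝ ℓ z U * gMet α p q z.1 V T + fderiv ℝ ℓ z V * gMet α p q z.1 U T
          - fderiv ℝ ℓ z T * gMet α p q z.1 U V) / 2 := by
  have h1 := hf.gMet_covHess_add hz U V T
  have h2 := hf.gMet_covHess_add hz V T U
  have h3 := hf.gMet_covHess_add hz T U V
  rw [hf.covHess_comm hz V U, gammaMap_comm _ V U,
    gMet_comm (f z).1 (fderiv ℝ f z T) (covHess α p q f z U V),
    gMet_comm z.1 T (gammaMap α p q z.1 U V), gMet_comm z.1 T U] at h2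
  rw [hf.covHess_comm hz T U, hf.covHess_comm hz T V, gammaMap_comm _ T U, gammaMap_comm _ T V,
    gMet_comm (f z).1 (fderiv ℝ f z U) (covHess α p q f z V T),
    gMet_comm z.1 U (gammaMap α p q z.1 V T)] at h3
  rw [gMet_comm (f z).1 (fderiv ℝ f z V) (covHess α p q f z U T),
    gMet_comm z.1 V (gammaMap α p q z.1 U T)] at h1
  linear_combination (h1 + h2 - h3) / 2

theorem fderiv_injective (hα : 0 < α) (hf : IsConformalOn α p q f Ω ℓ) {z : GVec p q}
    (hz : z ∈ Ω) : Function.Injective (fderiv ℝ f z) := by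
  rw [injective_iff_map_eq_zero]
  intro U hU
  by_contra h0
  have h1 := hf.gMet_map z hz U U
  rw [hU] at h1
  have h2 := mul_pos (hf.pos z hz) (gMet_self_pos hα (hf.ne_zero z hz) h0)
  rw [← h1] at h2
  simp [gMet] at h2

theorem fderiv_bijective (hα : 0 < α) (hf : IsConformalOn α p q f Ω ℓ) {z : GVec p q}
    (hz : z ∈ Ω) : Function.Bijective (fderiv ℝ f z) :=
  ⟨hf.fderiv_injective hα hz,
    (LinearMap.injective_iff_surjective (f := (fderiv ℝ f z : GVec p q →ₗ[ℝ] GVec p q))).1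
      (hf.fderiv_injective hα hz)⟩

theorem covHess_eq (hα : 0 < α) (hf : IsConformalOn α p q f Ω ℓ) {z : GVec p q} (hz : z ∈ Ω)
    {U V : GVec p q} (hUV : gMet α p q z.1 U V = 0) :
    covHess α p q f z U V = fderiv ℝ f z (gammaMap α p q z.1 U V
      + (2 * ℓ z)⁻¹ • (fderiv ℝ ℓ z U • V + fderiv ℝ ℓ z V • U)) := by
  have hℓ := (hf.pos z hz).ne'
  set Q := gammaMap α p q z.1 U V
      + (2 * ℓ z)⁻¹ • (fderiv ℝ ℓ z U • V + fderiv ℝ ℓ z V • U) with hQ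
  rw [← sub_eq_zero]
  by_contra h0
  obtain ⟨T, hT⟩ := (hf.fderiv_bijective hα hz).2 (covHess α p q f z U V - fderiv ℝ f z Q)
  have h1 := gMet_self_pos hα (hf.map_ne_zero z hz) h0
  nth_rewrite 2 [← hT] at h1
  rw [gMet_sub_left, hf.gMet_covHess hz, hf.gMet_map z hz, hUV, hQ, gMet_add_left,
    gMet_smul_left, gMet_add_left, gMet_smul_left, gMet_smul_left] at h1
  refine h1.ne' ?_
  field_simp
  ring

/-- The third-order identity obtained by differentiating the Koszul formula. -/
theorem deriv_gMet_covHess (hf : IsConformalOn α p q f Ω ℓ) {z : GVec p q} (hz : z ∈ Ω)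
    (X U V T : GVec p q) :
    gMet α p q (f z).1 (fderiv ℝ (fderiv ℝ (fderiv ℝ f)) z X U V
        + (gammaDer α p q (f z).1 (fderiv ℝ f z X) (fderiv ℝ f z U) (fderiv ℝ f z V)
          + gammaMap α p q (f z).1 (fderiv ℝ (fderiv ℝ f) z X U) (fderiv ℝ f z V)
          + gammaMap α p q (f z).1 (fderiv ℝ f z U) (fderiv ℝ (fderiv ℝ f) z X V))
        + gammaMap α p q (f z).1 (fderiv ℝ f z X) (covHess α p q f z U V)) (fderiv ℝ f z T)
      + gMet α p q (f z).1 (covHess α p q f z U V) (covHess α p q f z X T)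
      = fderiv ℝ ℓ z X * gMet α p q z.1 (gammaMap α p q z.1 U V) T
        + ℓ z * (gMet α p q z.1 (gammaDer α p q z.1 X U V
              + gammaMap α p q z.1 X (gammaMap α p q z.1 U V)) T
            + gMet α p q z.1 (gammaMap α p q z.1 U V) (gammaMap α p q z.1 X T))
        + ((fderiv ℝ (fderiv ℝ ℓ) z X U * gMet α p q z.1 V T
            + fderiv ℝ ℓ z U * (gMet α p q z.1 (gammaMap α p q z.1 X V) T
              + gMet α p q z.1 V (gammaMap α p q z.1 X T)))
          + (fderiv ℝ (fderiv ℝ ℓ) z X V * gMet α p q z.1 U T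
            + fderiv ℝ ℓ z V * (gMet α p q z.1 (gammaMap α p q z.1 X U) T
              + gMet α p q z.1 U (gammaMap α p q z.1 X T)))
          - (fderiv ℝ (fderiv ℝ ℓ) z X T * gMet α p q z.1 U V
            + fderiv ℝ ℓ z T * (gMet α p q z.1 (gammaMap α p q z.1 X U) V
              + gMet α p q z.1 U (gammaMap α p q z.1 X V)))) / 2 := by
  have hz0 : (z + (0 : ℝ) • X).1 ≠ 0 := by simpa using hf.ne_zero z hz
  have hfz0 : (f (z + (0 : ℝ) • X)).1 ≠ 0 := by simpa using hf.map_ne_zero z hz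
  have hline := hasDerivAt_add_smul z X
  have hfd := ((hf.contDiffAt z hz).differentiableAt (by simp)).hasDerivAt_add_smul X
  have hA := (hf.differentiableAt_fderiv hz).hasDerivAt_add_smul X
  have hD := ((hf.contDiffAt z hz).fderiv_top.fderiv_top.differentiableAt
    (by simp)).hasDerivAt_add_smul X
  have hℓ := ((hf.contDiffAt_factor z hz).differentiableAt (by simp)).hasDerivAt_add_smul X
  have hdℓ := ((hf.contDiffAt_factor z hz).fderiv_top.differentiableAt
    (by simp)).hasDerivAt_add_smul X
  have hN : HasDerivAt (fun t : ℝ => covHess α p q f (z + t • X) U V) _ 0 :=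
    ((hD.clm_apply_const U).clm_apply_const V).fun_add
      (hfd.gammaMap (hA.clm_apply_const U) (hA.clm_apply_const V) hfz0)
  have h1 := hfd.gMet (α := α) hN (hA.clm_apply_const T) hfz0
  have hc := fun W : GVec p q => hasDerivAt_const (0 : ℝ) W
  have hΓ := hline.gammaMap (α := α) (hc U) (hc V) hz0
  have h2 := (hℓ.fun_mul (hline.gMet (α := α) hΓ (hc T) hz0)).fun_add
    (((((hdℓ.clm_apply_const U).fun_mul (hline.gMet (α := α) (hc V) (hc T) hz0)).fun_add
      ((hdℓ.clm_apply_const V).fun_mul (hline.gMet (α := α) (hc U) (hc T) hz0))).fun_sub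
      ((hdℓ.clm_apply_const T).fun_mul (hline.gMet (α := α) (hc U) (hc V) hz0))).div_const 2)
  have h3 := h1.unique (h2.congr_of_eventuallyEq (by
    filter_upwards [hf.eventually_mem hz X] with t ht using hf.gMet_covHess ht U V T))
  have hΓ0 : ∀ x W, gammaMap α p q x 0 W = 0 := fun x W => by simp [gammaMap]
  have hΓ0' : ∀ x W, gammaMap α p q x W 0 = 0 := fun x W => by simp [gammaMap]
  simp only [zero_smul, add_zero, zero_add, hΓ0, hΓ0'] at h3
  exact h3

/-- The curvature is conformally covariant on orthogonal quadruples. -/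
theorem gMet_gCurv_map (hα : 0 < α) (hf : IsConformalOn α p q f Ω ℓ) {z : GVec p q}
    (hz : z ∈ Ω) {X U V T : GVec p q} (hXU : gMet α p q z.1 X U = 0)
    (hXV : gMet α p q z.1 X V = 0) (hXT : gMet α p q z.1 X T = 0) (hUV : gMet α p q z.1 U V = 0)
    (hUT : gMet α p q z.1 U T = 0) (hVT : gMet α p q z.1 V T = 0) :
    gMet α p q (f z).1 (gCurv α p q (f z).1 (fderiv ℝ f z X) (fderiv ℝ f z U) (fderiv ℝ f z V))
        (fderiv ℝ f z T)
      = ℓ z * gMet α p q z.1 (gCurv α p q z.1 X U V) T := by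
  have hℓ := (hf.pos z hz).ne'
  have hquad : ∀ {X U : GVec p q}, gMet α p q z.1 X U = 0 → gMet α p q z.1 X V = 0 →
      gMet α p q z.1 X T = 0 → gMet α p q z.1 U V = 0 → gMet α p q z.1 U T = 0 →
      gMet α p q (f z).1 (covHess α p q f z U V) (covHess α p q f z X T)
        = ℓ z * gMet α p q z.1 (gammaMap α p q z.1 U V) (gammaMap α p q z.1 X T)
          + (fderiv ℝ ℓ z X * gMet α p q z.1 (gammaMap α p q z.1 U V) T
            + fderiv ℝ ℓ z T * gMet α p q z.1 (gammaMap α p q z.1 U V) X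
            + fderiv ℝ ℓ z U * gMet α p q z.1 V (gammaMap α p q z.1 X T)
            + fderiv ℝ ℓ z V * gMet α p q z.1 U (gammaMap α p q z.1 X T)) / 2 := by
    intro X U h1 h2 h3 h4 h5
    rw [hf.covHess_eq hα hz h3, hf.gMet_covHess hz]
    simp only [gMet_add_right, gMet_smul_right]
    rw [gMet_comm z.1 U X, gMet_comm z.1 V X, h1, h2, h4, h5, hVT]
    field_simp
    ring
  have hUX : gMet α p q z.1 U X = 0 := by rw [gMet_comm, hXU]
  have e1 := hf.deriv_gMet_covHess hz X U V T
  have e2 := hf.deriv_gMet_covHess hz U X V T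
  rw [hquad hXU hXV hXT hUV hUT] at e1
  rw [hquad hUX hUV hUT hXV hXT] at e2
  have hs3 : fderiv ℝ (fderiv ℝ (fderiv ℝ f)) z X U V = fderiv ℝ (fderiv ℝ (fderiv ℝ f)) z U X V := by
    rw [(hf.contDiffAt z hz).fderiv_top.fderiv_fderiv_comm]
  rw [hs3] at e1
  simp only [covHess, gammaMap_add_right, gMet_add_left, hUV, hXV, hUT, hXT, hVT] at e1 e2
  rw [(hf.contDiffAt z hz).fderiv_fderiv_comm U X, gammaMap_comm z.1 U X,
    gMet_comm z.1 X (gammaMap α p q z.1 U V)] at e2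
  rw [gMet_comm z.1 U (gammaMap α p q z.1 X V)] at e1
  simp only [gCurv, gMet_sub_left, gMet_add_left]
  linear_combination e1 - e2

end IsConformalOn

end Conformal

section Splitting

variable {α : ℝ} {p q : ℕ}

theorem HasOrthPair.conj {V W : Type*} [AddCommGroup V] [Module ℝ V] [AddCommGroup W] [Module ℝ W]
    {B : LinearMap.BilinForm ℝ V} {B' : LinearMap.BilinForm ℝ W} {Q : W →ₗ[ℝ] W}
    (h : HasOrthPair B' Q) (A : V ≃ₗ[ℝ] W) {l : ℝ} (hl : l ≠ 0)
    (hA : ∀ x y, B' (A x) (A y) = l * B x y) :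
    HasOrthPair B (A.symm.toLinearMap ∘ₗ Q ∘ₗ A.toLinearMap) := by
  obtain ⟨a, b, ha, hb, ha0, hb0, hab⟩ := h
  refine ⟨A.symm a, A.symm b, by simp [ha], by simp [hb], by simpa using ha0, by simpa using hb0, ?_⟩
  have h1 := hA (A.symm a) (A.symm b)
  rw [A.apply_symm_apply, A.apply_symm_apply, hab] at h1
  exact (mul_eq_zero.1 h1.symm).resolve_left hl

/-- The orthogonal projection onto the vertical subspace, as a linear map. -/
def projL (p q : ℕ) (z : GVec p q) : GVec p q →ₗ[ℝ] GVec p q where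
  toFun := projS p q z
  map_add' U V := by
    ext i <;> simp [projS, inner_add_left]
    ring
  map_smul' r U := by
    ext i <;> simp [projS, real_inner_smul_left]
    ring

theorem projL_apply (z U : GVec p q) : projL p q z U = projS p q z U := rfl

theorem inner_projS_fst {z : GVec p q} (hz : z.1 ≠ 0) (U : GVec p q) :
    ⟪(projS p q z U).1, z.1⟫ = 0 := by
  have h : ‖z.1‖ ^ 2 ≠ 0 := by simpa using hz
  simp only [projS, inner_sub_left, real_inner_smul_left, real_inner_self_eq_norm_sq]
  field_simp
  ring

theorem mem_TSp_iff {z : GVec p q} (hz : z.1 ≠ 0) (U : GVec p q) :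
    U ∈ TSp p q z ↔ projS p q z U = U := by
  constructor
  · rintro ⟨h1, h2⟩
    ext i <;> simp [projS, h1, h2]
  · intro h
    rw [← h]
    exact ⟨rfl, inner_projS_fst hz U⟩

theorem mem_THp_iff {z : GVec p q} (hz : z.1 ≠ 0) (U : GVec p q) :
    U ∈ THp p q z ↔ projS p q z U = 0 := by
  have hn : ‖z.1‖ ^ 2 ≠ 0 := by simpa using hz
  constructor
  · rintro ⟨t, ht⟩
    refine Prod.ext ?_ rfl
    simp [projS, ht, real_inner_smul_left, hz]
  · intro h
    exact ⟨⟪U.1, z.1⟫ / ‖z.1‖ ^ 2, sub_eq_zero.1 (congrArg Prod.fst h)⟩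

theorem projL_projL {z : GVec p q} (hz : z.1 ≠ 0) (U : GVec p q) :
    projL p q z (projL p q z U) = projL p q z U :=
  (mem_TSp_iff hz _).1 ⟨rfl, inner_projS_fst hz U⟩

theorem gMet_projL_comm {z : GVec p q} (U V : GVec p q) :
    gMet α p q z.1 (projL p q z U) V = gMet α p q z.1 U (projL p q z V) := by
  simp only [projL_apply, gMet, projS, inner_sub_left, inner_sub_right, real_inner_smul_left,
    real_inner_smul_right, inner_zero_left, inner_zero_right, real_inner_comm z.1]
  ring

/-- The vector `∂_{y_1}`. -/
def unitY (p : ℕ) {q : ℕ} (hq : 1 ≤ q) : GVec p q := (0, EuclideanSpace.single ⟨0, hq⟩ 1)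

theorem gMet_unitY (hq : 1 ≤ q) (x : EuclideanSpace ℝ (Fin p)) :
    gMet α p q x (unitY p hq) (unitY p hq) = 1 := by
  simp [gMet, unitY]

theorem unitY_mem_THp (hq : 1 ≤ q) (z : GVec p q) : unitY p hq ∈ THp p q z :=
  ⟨0, by simp [unitY]⟩

theorem unitY_not_mem_TSp (hq : 1 ≤ q) (z : GVec p q) : unitY p hq ∉ TSp p q z := by
  rintro ⟨h, -⟩
  have := congrFun (congrArg WithLp.ofLp h) ⟨0, hq⟩
  simp [unitY] at this

theorem finrank_orthogonal_span {x : EuclideanSpace ℝ (Fin p)} (hx : x ≠ 0) :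
    Module.finrank ℝ (ℝ ∙ x)ᗮ = p - 1 := by
  have h := Submodule.finrank_add_finrank_orthogonal (ℝ ∙ x)
  rw [finrank_span_singleton hx, finrank_euclideanSpace_fin] at h
  omega

theorem hasOrthPair_projL (hp : 3 ≤ p) {z : GVec p q} (hz : z.1 ≠ 0) :
    HasOrthPair (gForm α z.1) (projL p q z) := by
  have hd := finrank_orthogonal_span hz
  let b := stdOrthonormalBasis ℝ (ℝ ∙ z.1)ᗮ
  have key : ∀ i, projL p q z ((b i : EuclideanSpace ℝ (Fin p)), 0) = (↑(b i), 0) := fun i =>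
    (mem_TSp_iff hz _).1 ⟨rfl, (Submodule.mem_orthogonal_singleton_iff_inner_left).1 (b i).2⟩
  have hne : ∀ i, ((b i : EuclideanSpace ℝ (Fin p)), (0 : EuclideanSpace ℝ (Fin q))) ≠ 0 :=
    fun i h => b.orthonormal.ne_zero i (Subtype.ext (congrArg Prod.fst h))
  let i0 : Fin (Module.finrank ℝ (ℝ ∙ z.1)ᗮ) := ⟨0, by omega⟩
  let i1 : Fin (Module.finrank ℝ (ℝ ∙ z.1)ᗮ) := ⟨1, by omega⟩
  have h01 : ⟪(b i0 : EuclideanSpace ℝ (Fin p)), b i1⟫ = 0 :=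
    b.orthonormal.2 (i := i0) (j := i1) (by simp [i0, i1])
  exact ⟨_, _, key i0, key i1, hne i0, hne i1, by simp [gForm, gMet, h01]⟩

theorem hasOrthPair_id_sub_projL (hq : 1 ≤ q) {z : GVec p q} (hz : z.1 ≠ 0) :
    HasOrthPair (gForm α z.1) (LinearMap.id - projL p q z) := by
  have h1 : projL p q z (z.1, 0) = 0 := (mem_THp_iff hz _).1 ⟨1, by simp⟩
  have h2 : projL p q z (unitY p hq) = 0 := (mem_THp_iff hz _).1 (unitY_mem_THp hq z)
  refine ⟨(z.1, 0), unitY p hq, by simp [h1], by simp [h2], fun h => hz (congrArg Prod.fst h),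
    fun h => unitY_not_mem_TSp hq z (h ▸ ⟨rfl, by simp⟩), by simp [gForm, gMet, unitY]⟩

theorem coe_range_projL {z : GVec p q} (hz : z.1 ≠ 0) :
    (LinearMap.range (projL p q z) : Set (GVec p q)) = TSp p q z := by
  ext U
  rw [mem_TSp_iff hz]
  constructor
  · rintro ⟨V, rfl⟩
    exact projL_projL hz V
  · exact fun h => ⟨U, h⟩

theorem coe_ker_projL {z : GVec p q} (hz : z.1 ≠ 0) :
    (LinearMap.ker (projL p q z) : Set (GVec p q)) = THp p q z := by
  ext U
  rw [mem_THp_iff hz]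
  rfl

theorem finrank_range_projL {z : GVec p q} (hz : z.1 ≠ 0) :
    Module.finrank ℝ (LinearMap.range (projL p q z)) = p - 1 := by
  have h : LinearMap.range (projL p q z)
      = (ℝ ∙ z.1)ᗮ.map (LinearMap.inl ℝ (EuclideanSpace ℝ (Fin p)) (EuclideanSpace ℝ (Fin q))) := by
    apply SetLike.coe_injective
    rw [coe_range_projL hz]
    ext U
    constructor
    · rintro ⟨h1, h2⟩
      exact ⟨U.1, Submodule.mem_orthogonal_singleton_iff_inner_left.2 h2, Prod.ext rfl h1.symm⟩
    · rintro ⟨v, hv, rfl⟩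
      exact ⟨rfl, Submodule.mem_orthogonal_singleton_iff_inner_left.1 hv⟩
  rw [h, ← (Submodule.equivMapOfInjective _ LinearMap.inl_injective _).finrank_eq, finrank_orthogonal_span hz]

theorem finrank_ker_projL {z : GVec p q} (hz : z.1 ≠ 0) :
    p - 1 + Module.finrank ℝ (LinearMap.ker (projL p q z)) = p + q := by
  have h := (projL p q z).finrank_range_add_finrank_ker
  rwa [finrank_range_projL hz, Module.finrank_prod, finrank_euclideanSpace_fin,
    finrank_euclideanSpace_fin] at h

/-- A linear isomorphism exchanging vertical and horizontal spaces forces equal dimensions. -/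
theorem sub_one_eq_add_one_of_image_TSp (hp : 1 ≤ p) {z w : GVec p q} (hz : z.1 ≠ 0) (hw : w.1 ≠ 0)
    {A : GVec p q →ₗ[ℝ] GVec p q} (hA : Function.Injective A)
    (h : A '' TSp p q z = THp p q w) : p - 1 = q + 1 := by
  have h1 : (LinearMap.range (projL p q z)).map A = LinearMap.ker (projL p q w) := by
    apply SetLike.coe_injective
    rw [Submodule.map_coe, coe_range_projL hz, coe_ker_projL hw, h]
  have h2 := finrank_ker_projL hw
  rw [← h1, ← (Submodule.equivMapOfInjective A hA _).finrank_eq, finrank_range_projL hz] at h2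
  omega

theorem Function.Bijective.image_eq_of_mem_iff {X Y : Type*} {A : X → Y} (hA : Function.Bijective A)
    {S : Set X} {T : Set Y} (h : ∀ x, x ∈ S ↔ A x ∈ T) : A '' S = T := by
  have : S = A ⁻¹' T := Set.ext h
  rw [this, Set.image_preimage_eq _ hA.2]

theorem Continuous.projS {X : Type*} [TopologicalSpace X] {w V : X → GVec p q}
    (hw : Continuous w) (hV : Continuous V) (h : ∀ x, (w x).1 ≠ 0) :
    Continuous fun x => projS p q (w x) (V x) := by
  refine Continuous.prodMk (hV.fst.sub (Continuous.fun_smul ?_ hw.fst)) continuous_const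
  exact (hV.fst.inner hw.fst).div (hw.fst.norm.pow 2) fun x => by simpa using h x

namespace IsConformalOn

variable {f : GVec p q → GVec p q} {Ω : Set (GVec p q)} {ℓ : GVec p q → ℝ}

theorem fderiv_projS_eq_or (hα : 0 < α) (hp : 3 ≤ p) (hq : 1 ≤ q)
    (hf : IsConformalOn α p q f Ω ℓ) {z : GVec p q} (hz : z ∈ Ω) :
    (∀ U, fderiv ℝ f z (projS p q z U) = projS p q (f z) (fderiv ℝ f z U)) ∨
      (∀ U, fderiv ℝ f z (U - projS p q z U) = projS p q (f z) (fderiv ℝ f z U)) := by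
  have hz0 := hf.ne_zero z hz
  have hw0 := hf.map_ne_zero z hz
  have hl := (hf.pos z hz).ne'
  let A : GVec p q ≃ₗ[ℝ] GVec p q :=
    LinearEquiv.ofBijective (fderiv ℝ f z : GVec p q →ₗ[ℝ] GVec p q) (hf.fderiv_bijective hα hz)
  have hA : ∀ x y, gForm α (f z).1 (A x) (A y) = ℓ z * gForm α z.1 x y := hf.gMet_map z hz
  let P' := A.symm.toLinearMap ∘ₗ projL p q (f z) ∘ₗ A.toLinearMap
  have hAP : ∀ U, projL p q (f z) (A U) = A (P' U) := fun U => by simp [P']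
  have hP' : ∀ U V, ℓ z * gForm α z.1 (P' U) V = gForm α (f z).1 (projL p q (f z) (A U)) (A V) :=
    fun U V => by rw [← hA, ← hAP]
  have hidP : LinearMap.id - P'
      = A.symm.toLinearMap ∘ₗ (LinearMap.id - projL p q (f z)) ∘ₗ A.toLinearMap := by
    refine LinearMap.ext fun U => ?_
    simp [P']
  have hk : gWeight α z.1 * ‖z.1‖ ^ 2 ≠ 0 :=
    mul_ne_zero (gWeight_pos hα hz0).ne' (by simpa using hz0)
  have hk' : gWeight α (f z).1 * ‖(f z).1‖ ^ 2 ≠ 0 :=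
    mul_ne_zero (gWeight_pos hα hw0).ne' (by simpa using hw0)
  have hα' : α * (α + 2) ≠ 0 := by positivity
  have hc : ℓ z * (gWeight α z.1 * ‖z.1‖ ^ 2) / (gWeight α (f z).1 * ‖(f z).1‖ ^ 2) ≠ 0 :=
    div_ne_zero (mul_ne_zero hl hk) hk'
  have hW : WeylRelated (gForm α z.1)
      (ℓ z * (gWeight α z.1 * ‖z.1‖ ^ 2) / (gWeight α (f z).1 * ‖(f z).1‖ ^ 2))
      (projL p q z) P' := by
    intro X U W T hXU hXW hXT hUW hUT hWT
    have h := hf.gMet_gCurv_map hα hz hXU hXW hXT hUW hUT hWT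
    rw [gMet_gCurv hα hz0, gMet_gCurv hα hw0] at h
    have e : ∀ U V, gMet α p q (f z).1 (projS p q (f z) (fderiv ℝ f z U)) (fderiv ℝ f z V)
      = ℓ z * gForm α z.1 (P' U) V := fun U V => (hP' U V).symm
    have e' : ∀ U V, gMet α p q z.1 (projS p q z U) V = gForm α z.1 (projL p q z U) V :=
      fun U V => rfl
    simp only [e, e'] at h
    have hw := (gWeight_pos hα hz0).ne'
    have hw' := (gWeight_pos hα hw0).ne'
    field_simp at h ⊢
    linear_combination -h
  have key := hW.eq_or_eq_compl (gMet_comm z.1) (fun x hx => gMet_self_pos hα hz0 hx)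
    (projL_projL hz0) gMet_projL_comm
    (fun x => A.injective (by rw [← hAP, ← hAP, projL_projL hw0]))
    (fun x y => mul_left_cancel₀ hl (by
      rw [hP']
      exact (gMet_projL_comm _ _).trans ((gMet_comm _ _ _).trans ((hP' y x).symm.trans
        (congrArg (ℓ z * ·) (gMet_comm _ _ _))))))
    hc (hasOrthPair_projL hp hz0) (hasOrthPair_id_sub_projL hq hz0)
    ((hasOrthPair_projL hp hw0).conj A hl hA)
    (hidP ▸ (hasOrthPair_id_sub_projL hq hw0).conj A hl hA)
  refine key.imp (fun h U => ?_) (fun h U => ?_)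
  · exact ((hAP U).trans (congrArg A (h U))).symm
  · exact ((hAP U).trans (congrArg A (h U))).symm

theorem image_of_fderiv_projS (hα : 0 < α) (hf : IsConformalOn α p q f Ω ℓ) {z : GVec p q}
    (hz : z ∈ Ω) (h : ∀ U, fderiv ℝ f z (projS p q z U) = projS p q (f z) (fderiv ℝ f z U)) :
    fderiv ℝ f z '' TSp p q z = TSp p q (f z) ∧ fderiv ℝ f z '' THp p q z = THp p q (f z) := by
  have hA := hf.fderiv_bijective hα hz
  refine ⟨hA.image_eq_of_mem_iff fun U => ?_, hA.image_eq_of_mem_iff fun U => ?_⟩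
  · rw [mem_TSp_iff (hf.ne_zero z hz), mem_TSp_iff (hf.map_ne_zero z hz), ← h, hA.1.eq_iff]
  · rw [mem_THp_iff (hf.ne_zero z hz), mem_THp_iff (hf.map_ne_zero z hz), ← h,
      map_eq_zero_iff _ hA.1]

theorem image_of_fderiv_sub_projS (hα : 0 < α) (hf : IsConformalOn α p q f Ω ℓ) {z : GVec p q}
    (hz : z ∈ Ω) (h : ∀ U, fderiv ℝ f z (U - projS p q z U) = projS p q (f z) (fderiv ℝ f z U)) :
    fderiv ℝ f z '' TSp p q z = THp p q (f z) ∧ fderiv ℝ f z '' THp p q z = TSp p q (f z) := by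
  have hA := hf.fderiv_bijective hα hz
  refine ⟨hA.image_eq_of_mem_iff fun U => ?_, hA.image_eq_of_mem_iff fun U => ?_⟩
  · rw [mem_TSp_iff (hf.ne_zero z hz), mem_THp_iff (hf.map_ne_zero z hz), ← h,
      map_eq_zero_iff _ hA.1, sub_eq_zero, eq_comm]
  · rw [mem_THp_iff (hf.ne_zero z hz), mem_TSp_iff (hf.map_ne_zero z hz), ← h, hA.1.eq_iff,
      sub_eq_self]

/-- By connectedness, the alternative does not depend on the point. -/
theorem forall_fderiv_projS_eq_or (hα : 0 < α) (hp : 3 ≤ p) (hq : 1 ≤ q)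
    (hf : IsConformalOn α p q f Ω ℓ) (hΩ : IsPreconnected Ω) :
    (∀ z ∈ Ω, ∀ U, fderiv ℝ f z (projS p q z U) = projS p q (f z) (fderiv ℝ f z U)) ∨
      (∀ z ∈ Ω, ∀ U, fderiv ℝ f z (U - projS p q z U) = projS p q (f z) (fderiv ℝ f z U)) := by
  have : PreconnectedSpace Ω := Subtype.preconnectedSpace hΩ
  have hcf : Continuous fun z : Ω => f z :=
    continuousOn_iff_continuous_domRestrict.1 fun z hz =>
      (hf.contDiffAt z hz).continuousAt.continuousWithinAt
  have hcD : Continuous fun z : Ω => fderiv ℝ f z :=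
    continuousOn_iff_continuous_domRestrict.1 fun z hz =>
      (hf.differentiableAt_fderiv hz).continuousAt.continuousWithinAt
  have hcP : ∀ U, Continuous fun z : Ω => projS p q (z : GVec p q) U := fun U =>
    continuous_subtype_val.projS continuous_const fun z => hf.ne_zero z z.2
  have hcQ : ∀ U, Continuous fun z : Ω => projS p q (f z) (fderiv ℝ f z U) := fun U =>
    hcf.projS (hcD.clm_apply continuous_const) fun z => hf.map_ne_zero z z.2
  let a : Set Ω := {z | ∀ U, fderiv ℝ f z (projS p q z U) = projS p q (f z) (fderiv ℝ f z U)}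
  let b : Set Ω := {z | ∀ U, fderiv ℝ f z (U - projS p q z U) = projS p q (f z) (fderiv ℝ f z U)}
  have ha : IsClosed a := by
    simp only [a, Set.ofPred_forall]
    exact isClosed_iInter fun U => isClosed_eq (hcD.clm_apply (hcP U)) (hcQ U)
  have hb : IsClosed b := by
    simp only [b, Set.ofPred_forall]
    exact isClosed_iInter fun U =>
      isClosed_eq (hcD.clm_apply (continuous_const.sub (hcP U))) (hcQ U)
  have hab : aᶜ = b := by
    ext z
    refine ⟨fun h => (hf.fderiv_projS_eq_or hα hp hq z.2).resolve_left h, fun h h' => ?_⟩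
    obtain ⟨v, -, hv, -, hv0, -⟩ := hasOrthPair_projL (α := α) (q := q) hp (hf.ne_zero z z.2)
    have h1 := (h v).trans (h' v).symm
    rw [← projL_apply, hv, sub_self, map_zero] at h1
    exact hv0 (hf.fderiv_injective hα z.2 (by rw [← h1, map_zero]))
  have hclopen : IsClopen a := ⟨ha, by rw [← isClosed_compl_iff, hab]; exact hb⟩
  rcases isClopen_iff.1 hclopen with h | h
  · right
    intro z hz
    have : (⟨z, hz⟩ : Ω) ∈ b := by rw [← hab, h]; simp
    exact this
  · left
    intro z hz
    have : (⟨z, hz⟩ : Ω) ∈ a := by rw [h]; simp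
    exact this

end IsConformalOn

/-- The conformal factor of a smooth conformal map is automatically smooth. -/
theorem isConformalOn_of_gMet_fderiv (hq : 1 ≤ q) {Ω : Set (GVec p q)} (hΩ : Ω ⊆ GM0 p q)
    (hΩo : IsOpen Ω) {f : GVec p q → GVec p q} (hmaps : Set.MapsTo f Ω (GM0 p q))
    (hf : ContDiffOn ℝ (⊤ : ℕ∞) f Ω) {u : GVec p q → ℝ} (hu : ∀ z ∈ Ω, 0 < u z)
    (hconf : ∀ z ∈ Ω, ∀ U V : GVec p q,
      gMet α p q (f z).1 (fderiv ℝ f z U) (fderiv ℝ f z V) = (u z ^ 2)⁻¹ * gMet α p q z.1 U V) :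
    IsConformalOn α p q f Ω fun z =>
      gMet α p q (f z).1 (fderiv ℝ f z (unitY p hq)) (fderiv ℝ f z (unitY p hq)) := by
  have hℓ : ∀ z ∈ Ω, gMet α p q (f z).1 (fderiv ℝ f z (unitY p hq)) (fderiv ℝ f z (unitY p hq))
      = (u z ^ 2)⁻¹ := fun z hz => by rw [hconf z hz, gMet_unitY, mul_one]
  have hcd : ∀ z ∈ Ω, ContDiffAt ℝ (⊤ : ℕ∞) f z := fun z hz => hf.contDiffAt (hΩo.mem_nhds hz)
  refine ⟨hΩo, hΩ, hmaps, hcd, fun z hz => ?_, fun z hz => ?_, fun z hz U V => ?_⟩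
  · have hD := (hcd z hz).fderiv_top.clm_apply (contDiffAt_const (c := unitY p hq))
    have hw : ContDiffAt ℝ (⊤ : ℕ∞) (fun z => ‖(f z).1‖ ^ (2 * α)) z :=
      ((hcd z hz).fst.norm ℝ (hmaps hz)).rpow_const_of_ne (norm_ne_zero_iff.2 (hmaps hz))
    exact ((contDiffAt_const.mul hw).mul (hD.fst.inner ℝ hD.fst)).add (hD.snd.inner ℝ hD.snd)
  · rw [hℓ z hz]
    have := hu z hz
    positivity
  · rw [hℓ z hz, hconf z hz]

end Splitting

/-- a conformal diffeomorphism either preserves or swaps the vertical and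
horizontal subspaces, uniformly on a connected open set; swapping forces `p − 1 = q + 1`. -/
theorem grushin_conformal_splitting
    (α : ℝ) (hα : 0 < α) (p q : ℕ) (hp : 3 ≤ p) (hq : 1 ≤ q)
    (Ω : Set (GVec p q)) (hΩ : Ω ⊆ GM0 p q) (hΩo : IsOpen Ω) (hΩc : IsConnected Ω)
    (f : GVec p q → GVec p q) (hmaps : Set.MapsTo f Ω (GM0 p q))
    (hf : ContDiffOn ℝ (⊤ : ℕ∞) f Ω) (hinj : Set.InjOn f Ω)
    (u : GVec p q → ℝ) (hu : ∀ z ∈ Ω, 0 < u z)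
    (hconf : ∀ z ∈ Ω, ∀ U V : GVec p q,
      gMet α p q (f z).1 (fderiv ℝ f z U) (fderiv ℝ f z V) = (u z ^ 2)⁻¹ * gMet α p q z.1 U V) :
    Xor'
      (∀ z ∈ Ω, ⇑(fderiv ℝ f z) '' TSp p q z = TSp p q (f z) ∧
        ⇑(fderiv ℝ f z) '' THp p q z = THp p q (f z))
      (∀ z ∈ Ω, ⇑(fderiv ℝ f z) '' TSp p q z = THp p q (f z) ∧
        ⇑(fderiv ℝ f z) '' THp p q z = TSp p q (f z))
    ∧ ((∀ z ∈ Ω, ⇑(fderiv ℝ f z) '' TSp p q z = THp p q (f z) ∧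
        ⇑(fderiv ℝ f z) '' THp p q z = TSp p q (f z)) → p - 1 = q + 1) := by
  have h := isConformalOn_of_gMet_fderiv hq hΩ hΩo hmaps hf hu hconf
  obtain ⟨z, hz⟩ := hΩc.nonempty
  refine ⟨?_, fun hswap => sub_one_eq_add_one_of_image_TSp (by omega) (hΩ hz) (hmaps hz)
    (A := fderiv ℝ f z) (h.fderiv_injective hα hz) (hswap z hz).1⟩
  have hne : TSp p q (f z) ≠ THp p q (f z) := fun e =>
    unitY_not_mem_TSp hq (f z) (e ▸ unitY_mem_THp hq (f z))
  rcases h.forall_fderiv_projS_eq_or hα hp hq hΩc.isPreconnected with h1 | h1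
  · have h2 := fun z hz => h.image_of_fderiv_projS hα hz (h1 z hz)
    exact Or.inl ⟨h2, fun h3 => hne ((h2 z hz).1.symm.trans (h3 z hz).1)⟩
  · have h2 := fun z hz => h.image_of_fderiv_sub_projS hα hz (h1 z hz)
    exact Or.inr ⟨h2, fun h3 => hne ((h3 z hz).1.symm.trans (h2 z hz).1)⟩

end
end

section
/- Let Ω ⊂ M₀ be a connected open set and let f : Ω → f(Ω) ⊂ M₀ be a conformal diffeomorphism with respect to g with conformal factor u. Identify M₀ with H × S via z = (x,y) ↔ (h, s) with h = (r, y) = (|x|^{α+1}, y) ∈ H = (0,∞) × ℝ^q and s = x/|x| ∈ S = S^{p−1}. If, in these coordinates, f is a product map of the form (h, s) ↦ (h̃(h), s̃(s)) or of the form (h, s) ↦ (h̃(s), s̃(h)), then the conformal factor is a product: there exist functions A on H and B on S^{p−1} such that u(h, s) = A(h) B(s). -/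
noncomputable section

open scoped RealInnerProductSpace

theorem gMet_self (α : ℝ) (p q : ℕ) (x : EuclideanSpace ℝ (Fin p)) (U : GVec p q) :
    gMet α p q x U U = (α + 1) ^ 2 * ‖x‖ ^ (2 * α) * ‖U.1‖ ^ 2 + ‖U.2‖ ^ 2 := by
  simp only [gMet, real_inner_self_eq_norm_sq]

/-- Two curves with equal `H`-components and constant `S`-components have velocities of equal
`g`-length. -/
theorem gMet_velocity_eq (α : ℝ) (p q : ℕ) {c c' : ℝ → GVec p q} {W W' : GVec p q}
    (hc : HasDerivAt c W 0) (hc' : HasDerivAt c' W' 0)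
    (h0 : (c 0).1 ≠ 0)
    (hev : ∀ᶠ t in nhds (0 : ℝ), ‖(c t).1‖ = ‖(c' t).1‖ ∧ (c t).2 = (c' t).2 ∧
      ‖(c t).1‖⁻¹ • (c t).1 = ‖(c 0).1‖⁻¹ • (c 0).1 ∧
      ‖(c' t).1‖⁻¹ • (c' t).1 = ‖(c' 0).1‖⁻¹ • (c' 0).1) :
    gMet α p q (c 0).1 W W = gMet α p q (c' 0).1 W' W' := by
  have hnorm := hev.self_of_nhds.1
  have h0' : (c' 0).1 ≠ 0 := by
    rw [← norm_ne_zero_iff, ← hnorm]; exact norm_ne_zero_iff.2 h0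
  have hc1 : HasDerivAt (fun t => (c t).1) W.1 0 := hc.fst
  have hc1' : HasDerivAt (fun t => (c' t).1) W'.1 0 := hc'.fst
  have hρ : HasDerivAt (fun t => ‖(c t).1‖) (deriv (fun t => ‖(c t).1‖) 0) 0 :=
    (hc1.differentiableAt.norm ℝ h0).hasDerivAt
  set d := deriv (fun t => ‖(c t).1‖) 0
  have polar : ∀ v : EuclideanSpace ℝ (Fin p), v = ‖v‖ • (‖v‖⁻¹ • v) := fun v => by
    rcases eq_or_ne v 0 with rfl | hv
    · simp
    · rw [smul_inv_smul₀ (norm_ne_zero_iff.2 hv)]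
  have e1 : W.1 = d • (‖(c 0).1‖⁻¹ • (c 0).1) := by
    refine hc1.unique ((hρ.smul_const _).congr_of_eventuallyEq ?_)
    filter_upwards [hev] with t ht
    rw [← ht.2.2.1]
    exact polar _
  have e1' : W'.1 = d • (‖(c' 0).1‖⁻¹ • (c' 0).1) := by
    refine hc1'.unique ((hρ.smul_const _).congr_of_eventuallyEq ?_)
    filter_upwards [hev] with t ht
    rw [← ht.2.2.2, ht.1]
    exact polar _
  have e2 : W.2 = W'.2 := by
    have hc2 : HasDerivAt (fun t => (c t).2) W.2 0 := hc.snd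
    have hc2' : HasDerivAt (fun t => (c' t).2) W'.2 0 := hc'.snd
    refine hc2.unique (hc2'.congr_of_eventuallyEq ?_)
    filter_upwards [hev] with t ht using ht.2.1
  have n1 : ‖W.1‖ = ‖W'.1‖ := by
    rw [e1, e1', norm_smul d, norm_smul d]
    congr 1
    exact (norm_smul_inv_norm (𝕜 := ℝ) h0).trans (norm_smul_inv_norm (𝕜 := ℝ) h0').symm
  rw [gMet_self, gMet_self, n1, e2, hnorm]

theorem exists_orthogonal_norm_eq {p : ℕ} (hp : 2 ≤ p) (x : EuclideanSpace ℝ (Fin p)) :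
    ∃ v : EuclideanSpace ℝ (Fin p), ⟪x, v⟫ = 0 ∧ ‖v‖ = ‖x‖ := by
  have hne : (Submodule.span ℝ {x})ᗮ ≠ ⊥ := by
    intro h
    rw [Submodule.orthogonal_eq_bot_iff] at h
    have h1 := finrank_span_le_card (R := ℝ) ({x} : Set (EuclideanSpace ℝ (Fin p)))
    rw [h, finrank_top, finrank_euclideanSpace_fin] at h1
    simp at h1
    omega
  obtain ⟨w, hw, hw0⟩ := Submodule.exists_mem_ne_zero_of_ne_bot hne
  rw [Submodule.mem_orthogonal_singleton_iff_inner_right] at hw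
  refine ⟨(‖x‖ * ‖w‖⁻¹) • w, by rw [inner_smul_right, hw, mul_zero], ?_⟩
  have : ‖w‖ ≠ 0 := norm_ne_zero_iff.2 hw0
  rw [norm_smul, norm_mul, norm_norm, norm_inv, norm_norm]
  field_simp

theorem norm_cos_smul_add_sin_smul {E : Type*} [NormedAddCommGroup E] [InnerProductSpace ℝ E]
    {x v : E} (hv : ⟪x, v⟫ = 0) (hn : ‖v‖ = ‖x‖) (t : ℝ) :
    ‖Real.cos t • x + Real.sin t • v‖ = ‖x‖ := by
  rw [← sq_eq_sq₀ (norm_nonneg _) (norm_nonneg _), norm_add_sq_real, inner_smul_left,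
    inner_smul_right, hv, norm_smul, norm_smul, hn, mul_pow, mul_pow, Real.norm_eq_abs,
    Real.norm_eq_abs, sq_abs, sq_abs]
  linear_combination ‖x‖ ^ 2 * Real.cos_sq_add_sin_sq t

theorem hasDerivAt_cos_smul_add_sin_smul {E : Type*} [NormedAddCommGroup E] [NormedSpace ℝ E]
    (x v : E) : HasDerivAt (fun t : ℝ => Real.cos t • x + Real.sin t • v) v 0 := by
  have h := ((Real.hasDerivAt_cos 0).smul_const x).fun_add ((Real.hasDerivAt_sin 0).smul_const v)
  simpa using h

/-- The infinitesimal relation behind the product structure: if two curves in `Ω` are mapped to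
curves with equal `H`-components and constant `S`-components, their conformally rescaled initial
velocities have equal `g`-length. -/
theorem conformal_velocity_eq (α : ℝ) (p q : ℕ) {Ω : Set (GVec p q)} (hΩo : IsOpen Ω)
    {f : GVec p q → GVec p q} (hmaps : Set.MapsTo f Ω (GM0 p q)) (hf : DifferentiableOn ℝ f Ω)
    {u : GVec p q → ℝ}
    (hconf : ∀ z ∈ Ω, ∀ U V : GVec p q,
      gMet α p q (f z).1 (fderiv ℝ f z U) (fderiv ℝ f z V) = (u z ^ 2)⁻¹ * gMet α p q z.1 U V)
    {c c' : ℝ → GVec p q} {V V' : GVec p q}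
    (hc : HasDerivAt c V 0) (hc' : HasDerivAt c' V' 0) (hz : c 0 ∈ Ω) (hz' : c' 0 ∈ Ω)
    (hcurve : ∀ t, c t ∈ Ω → c' t ∈ Ω →
      ‖(f (c t)).1‖ = ‖(f (c' t)).1‖ ∧ (f (c t)).2 = (f (c' t)).2 ∧
      ‖(f (c t)).1‖⁻¹ • (f (c t)).1 = ‖(f (c 0)).1‖⁻¹ • (f (c 0)).1 ∧
      ‖(f (c' t)).1‖⁻¹ • (f (c' t)).1 = ‖(f (c' 0)).1‖⁻¹ • (f (c' 0)).1) :
    (u (c 0) ^ 2)⁻¹ * gMet α p q (c 0).1 V V = (u (c' 0) ^ 2)⁻¹ * gMet α p q (c' 0).1 V' V' := by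
  rw [← hconf _ hz, ← hconf _ hz']
  have hd : HasDerivAt (fun t => f (c t)) (fderiv ℝ f (c 0) V) 0 :=
    (hf.differentiableAt (hΩo.mem_nhds hz)).hasFDerivAt.comp_hasDerivAt 0 hc
  have hd' : HasDerivAt (fun t => f (c' t)) (fderiv ℝ f (c' 0) V') 0 :=
    (hf.differentiableAt (hΩo.mem_nhds hz')).hasFDerivAt.comp_hasDerivAt 0 hc'
  refine gMet_velocity_eq α p q (c := fun t => f (c t)) (c' := fun t => f (c' t)) hd hd'
    (hmaps hz) ?_
  filter_upwards [hc.continuousAt.eventually_mem (hΩo.mem_nhds hz),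
    hc'.continuousAt.eventually_mem (hΩo.mem_nhds hz')] with t ht ht' using hcurve t ht ht'

/-- if a conformal map is a product map in the warped coordinates
`(h, s) = ((|x|^{α+1}, y), x/|x|)`, then its conformal factor is a product `A(h)B(s)`. -/
theorem grushin_conformal_factor_is_product
    (α : ℝ) (hα : 0 < α) (p q : ℕ) (hp : 2 ≤ p) (hq : 1 ≤ q)
    (Ω : Set (GVec p q)) (hΩ : Ω ⊆ GM0 p q) (hΩo : IsOpen Ω) (hΩc : IsConnected Ω)
    (f : GVec p q → GVec p q) (hmaps : Set.MapsTo f Ω (GM0 p q))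
    (hf : ContDiffOn ℝ (⊤ : ℕ∞) f Ω) (hinj : Set.InjOn f Ω)
    (u : GVec p q → ℝ) (hu : ∀ z ∈ Ω, 0 < u z)
    (hconf : ∀ z ∈ Ω, ∀ U V : GVec p q,
      gMet α p q (f z).1 (fderiv ℝ f z U) (fderiv ℝ f z V) = (u z ^ 2)⁻¹ * gMet α p q z.1 U V)
    (hprod :
      (∃ (ht : ℝ × EuclideanSpace ℝ (Fin q) → ℝ × EuclideanSpace ℝ (Fin q))
         (st : EuclideanSpace ℝ (Fin p) → EuclideanSpace ℝ (Fin p)),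
        ∀ z ∈ Ω, ((‖(f z).1‖ ^ (α + 1), (f z).2) = ht (‖z.1‖ ^ (α + 1), z.2) ∧
          ‖(f z).1‖⁻¹ • (f z).1 = st (‖z.1‖⁻¹ • z.1)))
      ∨ (∃ (ht : EuclideanSpace ℝ (Fin p) → ℝ × EuclideanSpace ℝ (Fin q))
           (st : ℝ × EuclideanSpace ℝ (Fin q) → EuclideanSpace ℝ (Fin p)),
        ∀ z ∈ Ω, ((‖(f z).1‖ ^ (α + 1), (f z).2) = ht (‖z.1‖⁻¹ • z.1) ∧
          ‖(f z).1‖⁻¹ • (f z).1 = st (‖z.1‖ ^ (α + 1), z.2)))) :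
    ∃ (A : ℝ × EuclideanSpace ℝ (Fin q) → ℝ) (B : EuclideanSpace ℝ (Fin p) → ℝ),
      ∀ z ∈ Ω, u z = A (‖z.1‖ ^ (α + 1), z.2) * B (‖z.1‖⁻¹ • z.1) := by
  have hα1 : α + 1 ≠ 0 := by positivity
  have hfd : DifferentiableOn ℝ f Ω := hf.differentiableOn (by simp)
  have rpow_inj : ∀ a b : EuclideanSpace ℝ (Fin p), ‖a‖ ^ (α + 1) = ‖b‖ ^ (α + 1) → ‖a‖ = ‖b‖ :=
    fun a b h => (Real.rpow_left_inj (norm_nonneg _) (norm_nonneg _) hα1).1 h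
  rcases hprod with ⟨ht, st, hfs⟩ | ⟨ht, st, hfs⟩
  · let φ : Ω → ℝ × EuclideanSpace ℝ (Fin q) := fun z => (‖z.1.1‖ ^ (α + 1), z.1.2)
    have hfac : Function.FactorsThrough (fun z : Ω => u z) φ := by
      rintro ⟨⟨x, y⟩, hz⟩ ⟨⟨x', y'⟩, hz'⟩ hφ
      obtain ⟨hx, rfl⟩ : ‖x‖ ^ (α + 1) = ‖x'‖ ^ (α + 1) ∧ y = y' := by simpa [φ] using hφ
      let w : EuclideanSpace ℝ (Fin q) := EuclideanSpace.single ⟨0, hq⟩ 1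
      have hcurve (a : EuclideanSpace ℝ (Fin p)) :
          HasDerivAt (fun t : ℝ => (a, y + t • w)) (0, w) 0 := by
        refine (hasDerivAt_const 0 a).prodMk ?_
        simpa using ((hasDerivAt_id (0 : ℝ)).smul_const w).const_add y
      have key := conformal_velocity_eq α p q hΩo hmaps hfd hconf (hcurve x) (hcurve x')
        (by simpa using hz) (by simpa using hz') (fun t h h' => by
          have e := (hfs _ h).1.trans ((congrArg (fun r => ht (r, y + t • w)) hx).trans
            (hfs _ h').1.symm)
          refine ⟨rpow_inj _ _ (Prod.mk.inj e).1, (Prod.mk.inj e).2, ?_, ?_⟩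
          · exact (hfs _ h).2.trans (hfs (x, y + (0 : ℝ) • w) (by simpa using hz)).2.symm
          · exact (hfs _ h').2.trans (hfs (x', y + (0 : ℝ) • w) (by simpa using hz')).2.symm)
      have key' : u (x, y) ^ 2 = u (x', y) ^ 2 := by
        simpa [gMet_self, w] using key
      exact (sq_eq_sq₀ (hu _ hz).le (hu _ hz').le).1 key'
    obtain ⟨A, hA⟩ := Function.factorsThrough_iff _ |>.1 hfac
    exact ⟨A, fun _ => 1, fun z hz => by simpa [φ] using congrFun hA ⟨z, hz⟩⟩
  · let φ : Ω → EuclideanSpace ℝ (Fin p) := fun z => ‖z.1.1‖⁻¹ • z.1.1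
    have hfac : Function.FactorsThrough (fun z : Ω => u z / ‖z.1.1‖ ^ (α + 1)) φ := by
      rintro ⟨⟨x, y⟩, hz⟩ ⟨⟨x', y'⟩, hz'⟩ hφ
      have hφ : ‖x‖⁻¹ • x = ‖x'‖⁻¹ • x' := hφ
      have hx : 0 < ‖x‖ := norm_pos_iff.2 (hΩ hz)
      have hx' : 0 < ‖x'‖ := norm_pos_iff.2 (hΩ hz')
      obtain ⟨v, hv, hvn⟩ := exists_orthogonal_norm_eq hp x
      let k := ‖x'‖ * ‖x‖⁻¹
      have hk : 0 < k := by positivity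
      have hkx : x' = k • x := by
        rw [mul_smul, hφ, smul_inv_smul₀ hx'.ne']
      have hv' : ⟪x', k • v⟫ = 0 := by rw [hkx, inner_smul_left, inner_smul_right, hv]; simp
      have hvn' : ‖k • v‖ = ‖x'‖ := by rw [hkx, norm_smul, norm_smul, hvn]
      have hcurve (a b : EuclideanSpace ℝ (Fin p)) (y : EuclideanSpace ℝ (Fin q)) :
          HasDerivAt (fun t : ℝ => (Real.cos t • a + Real.sin t • b, y)) (b, 0) 0 :=
        (hasDerivAt_cos_smul_add_sin_smul a b).prodMk (hasDerivAt_const 0 y)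
      have hdir (t : ℝ) : ‖Real.cos t • x + Real.sin t • v‖⁻¹ • (Real.cos t • x + Real.sin t • v) =
          ‖Real.cos t • x' + Real.sin t • k • v‖⁻¹ • (Real.cos t • x' + Real.sin t • k • v) := by
        rw [norm_cos_smul_add_sin_smul hv hvn, norm_cos_smul_add_sin_smul hv' hvn', smul_add,
          smul_add, smul_comm _ (Real.cos t) x, smul_comm _ (Real.cos t) x', hφ,
          smul_comm (Real.sin t) k v, smul_smul _ k]
        congr 2
        simp only [k]
        field_simp
      have key := conformal_velocity_eq α p q hΩo hmaps hfd hconf (hcurve x v y)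
        (hcurve x' (k • v) y') (by simpa using hz) (by simpa using hz') (fun t h h' => by
          have e := (hfs _ h).1.trans ((congrArg ht (hdir t)).trans (hfs _ h').1.symm)
          have aux {a b : EuclideanSpace ℝ (Fin p)} {y : EuclideanSpace ℝ (Fin q)}
              (hab : ⟪a, b⟫ = 0) (hn : ‖b‖ = ‖a‖) :
              st (‖Real.cos t • a + Real.sin t • b‖ ^ (α + 1), y) =
              st (‖Real.cos 0 • a + Real.sin 0 • b‖ ^ (α + 1), y) := by
            rw [norm_cos_smul_add_sin_smul hab hn, norm_cos_smul_add_sin_smul hab hn]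
          refine ⟨rpow_inj _ _ (Prod.mk.inj e).1, (Prod.mk.inj e).2, ?_, ?_⟩
          · exact (hfs _ h).2.trans ((aux hv hvn).trans (hfs (_, y) (by simpa using hz)).2.symm)
          · exact (hfs _ h').2.trans
              ((aux hv' hvn').trans (hfs (_, y') (by simpa using hz')).2.symm))
      have hpow {r : ℝ} (hr : 0 < r) : r ^ (2 * α) * r ^ 2 = (r ^ (α + 1)) ^ 2 := by
        rw [← Real.rpow_natCast r 2, ← Real.rpow_add hr, ← Real.rpow_mul_natCast hr.le]
        congr 1; push_cast; ring
      simp only [gMet_self, hvn, hvn', Real.cos_zero, Real.sin_zero, one_smul, zero_smul, add_zero,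
        norm_zero, mul_assoc, hpow hx, hpow hx'] at key
      have hux := hu _ hz
      have hux' := hu _ hz'
      have hr : 0 < ‖x‖ ^ (α + 1) := by positivity
      have hr' : 0 < ‖x'‖ ^ (α + 1) := by positivity
      change u (x, y) / ‖x‖ ^ (α + 1) = u (x', y') / ‖x'‖ ^ (α + 1)
      rw [div_eq_div_iff hr.ne' hr'.ne', ← sq_eq_sq₀ (by positivity) (by positivity)]
      field_simp at key
      refine mul_left_cancel₀ (pow_ne_zero 2 hα1) ?_
      linear_combination -key
    obtain ⟨B, hB⟩ := Function.factorsThrough_iff _ |>.1 hfac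
    refine ⟨fun h => h.1, B, fun z hz => ?_⟩
    have hr : ‖z.1‖ ^ (α + 1) ≠ 0 :=
      (Real.rpow_pos_of_pos (norm_pos_iff.2 (hΩ hz)) _).ne'
    have h : u z / ‖z.1‖ ^ (α + 1) = B (‖z.1‖⁻¹ • z.1) := congrFun hB ⟨z, hz⟩
    rw [← h, mul_div_cancel₀ _ hr]

end
end
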